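/- Let 2 < q < p ≤ 2_s^* and λ > 0. If u is a positive weak solution of (P_λ), then u satisfies the Pohozaev identity (N−2s)[u]_{H^s}² = 2N( (1/p)∫_{ℝ^N} |u|^p dx + (λ/q)∫_{ℝ^N} |u|^q dx − ½∫_{ℝ^N} |u|² dx ). -/

import Mathlib

open MeasureTheory Real Filter Set Topology Asymptotics
open scoped Classical

noncomputable section

/-- Euclidean space `ℝ^N`. -/
abbrev RN (N : ℕ) := EuclideanSpace ℝ (Fin N)

/-- The critical fractional Sobolev exponent `2_s^* = 2N/(N-2s)`. -/
def critExp (N : ℕ) (s : ℝ) : ℝ := 2 * N / ((N : ℝ) - 2 * s)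

/-- The squared Gagliardo seminorm `[u]_{H^s}²`. -/
def gagliardoSq (N : ℕ) (s : ℝ) (u : RN N → ℝ) : ℝ :=
  ∫ z : RN N × RN N, (u z.1 - u z.2) ^ 2 / ‖z.1 - z.2‖ ^ ((N : ℝ) + 2 * s)

/-- Membership in the fractional Sobolev space `H^s(ℝ^N)`: `u ∈ L²` and the
Gagliardo seminorm is finite. -/
def MemHs (N : ℕ) (s : ℝ) (u : RN N → ℝ) : Prop :=
  Integrable (fun x : RN N => (u x) ^ 2) ∧
  Integrable (fun z : RN N × RN N => (u z.1 - u z.2) ^ 2 / ‖z.1 - z.2‖ ^ ((N : ℝ) + 2 * s))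

/-- `‖u‖_r^r = ∫ |u|^r`. -/
def lpPow (N : ℕ) (r : ℝ) (u : RN N → ℝ) : ℝ := ∫ x : RN N, |u x| ^ r

/-- `u` is a weak solution of `(-Δ)^s u + u = |u|^{p-2}u + λ|u|^{q-2}u` in `ℝ^N`. -/
def IsWeakSolution (N : ℕ) (s p q lam : ℝ) (u : RN N → ℝ) : Prop :=
  MemHs N s u ∧ ∀ φ : RN N → ℝ, MemHs N s φ →
    (∫ z : RN N × RN N, (u z.1 - u z.2) * (φ z.1 - φ z.2) / ‖z.1 - z.2‖ ^ ((N : ℝ) + 2 * s))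
      + (∫ x : RN N, u x * φ x)
    = (∫ x : RN N, |u x| ^ (p - 2) * u x * φ x)
      + lam * ∫ x : RN N, |u x| ^ (q - 2) * u x * φ x

/-- The energy functional `I_λ`. -/
def energy (N : ℕ) (s p q lam : ℝ) (u : RN N → ℝ) : ℝ :=
  (1 / 2) * gagliardoSq N s u + (1 / 2) * lpPow N 2 u
    - (1 / p) * lpPow N p u - (lam / q) * lpPow N q u

/-- `u` is a ground state solution of `(P_λ)`. -/
def IsGroundState (N : ℕ) (s p q lam : ℝ) (u : RN N → ℝ) : Prop :=
  IsWeakSolution N s p q lam u ∧ u ≠ 0 ∧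
    energy N s p q lam u =
      sInf {E : ℝ | ∃ v : RN N → ℝ, IsWeakSolution N s p q lam v ∧ v ≠ 0 ∧ E = energy N s p q lam v}

/-- `u` is radially symmetric. -/
def IsRadial (N : ℕ) (u : RN N → ℝ) : Prop :=
  ∃ f : ℝ → ℝ, ∀ x, u x = f ‖x‖

/-- `u` is radially symmetric and radially decreasing. -/
def IsRadialDecreasing (N : ℕ) (u : RN N → ℝ) : Prop :=
  ∃ f : ℝ → ℝ, (∀ x, u x = f ‖x‖) ∧ AntitoneOn f (Ici 0)

/-- `f(λ) ∼ g(λ)` for small `λ > 0`: two-sided comparison with positive constants. -/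
def SimEq (f g : ℝ → ℝ) : Prop :=
  ∃ C₁ C₂ lam₀ : ℝ, 0 < C₁ ∧ 0 < C₂ ∧ 0 < lam₀ ∧
    ∀ lam : ℝ, 0 < lam → lam ≤ lam₀ → C₁ * g lam ≤ f lam ∧ f lam ≤ C₂ * g lam

/-- `f(λ) ≲ g(λ)` for small `λ > 0`. -/
def LesssimEq (f g : ℝ → ℝ) : Prop :=
  ∃ C lam₀ : ℝ, 0 < C ∧ 0 < lam₀ ∧ ∀ lam : ℝ, 0 < lam → lam ≤ lam₀ → f lam ≤ C * g lam

/-- Squared `H^s` norm. -/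
def hsNormSq (N : ℕ) (s : ℝ) (u : RN N → ℝ) : ℝ := lpPow N 2 u + gagliardoSq N s u

/-- The (extended-real-valued) Hölder norm of order `α`: sup norm plus Hölder seminorm. -/
def holderENorm (N : ℕ) (α : ℝ) (f : RN N → ℝ) : ENNReal :=
  (⨆ x : RN N, (‖f x‖₊ : ENNReal)) +
    ⨆ x : RN N, ⨆ y : RN N,
      if x = y then 0 else (‖f x - f y‖₊ : ENNReal) / (‖x - y‖₊ : ENNReal) ^ α

/-- The Aubin–Talenti bubble `U₁(x) = c (1+|x|²)^{-(N-2s)/2}`. -/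
def U1 (N : ℕ) (s c : ℝ) (x : RN N) : ℝ := c * (1 + ‖x‖ ^ 2) ^ (-(((N : ℝ) - 2 * s) / 2))

/-- The rescaled bubble `U_ρ(x) = ρ^{-(N-2s)/2} U₁(x/ρ)`. -/
def Urho (N : ℕ) (s c ρ : ℝ) (x : RN N) : ℝ :=
  ρ ^ (-(((N : ℝ) - 2 * s) / 2)) * U1 N s c (ρ⁻¹ • x)

/-- `U₁` (with constant `c`) is a weak solution of the critical Emden–Fowler equation
`(-Δ)^s U = U^{2_s^*-1}` in `ℝ^N`. -/
def IsEmdenFowlerSolution (N : ℕ) (s c : ℝ) : Prop :=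
  ∀ φ : RN N → ℝ, MemHs N s φ →
    (∫ z : RN N × RN N,
        (U1 N s c z.1 - U1 N s c z.2) * (φ z.1 - φ z.2) / ‖z.1 - z.2‖ ^ ((N : ℝ) + 2 * s))
      = ∫ x : RN N, |U1 N s c x| ^ (critExp N s - 2) * U1 N s c x * φ x

/-- The rescaling `v(x) = λ^{1/(q-2)} u(λ^{(2_s^*-2)/(2s(q-2))} x)`. -/
def rescale (N : ℕ) (s q : ℝ) (u : RN N → ℝ) (lam : ℝ) : RN N → ℝ :=
  fun x => lam ^ (1 / (q - 2)) * u ((lam ^ ((critExp N s - 2) / (2 * s * (q - 2)))) • x)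

/-- The rescaled energy functional `J_λ`, with `σ = (2_s^*-2)/(q-2)`. -/
def Jfun (N : ℕ) (s q lam : ℝ) (v : RN N → ℝ) : ℝ :=
  (1 / 2) * gagliardoSq N s v + (lam ^ ((critExp N s - 2) / (q - 2)) / 2) * lpPow N 2 v
    - (1 / critExp N s) * lpPow N (critExp N s) v
    - (lam ^ ((critExp N s - 2) / (q - 2)) / q) * lpPow N q v

/-- `m_λ`: infimum of `J_λ` over the Nehari manifold `𝒩_λ`. -/
def mJ (N : ℕ) (s q lam : ℝ) : ℝ :=
  sInf {E : ℝ | ∃ v : RN N → ℝ, MemHs N s v ∧ v ≠ 0 ∧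
    gagliardoSq N s v + lam ^ ((critExp N s - 2) / (q - 2)) * lpPow N 2 v
      = lpPow N (critExp N s) v + lam ^ ((critExp N s - 2) / (q - 2)) * lpPow N q v ∧
    E = Jfun N s q lam v}

/-- `m₀`: infimum of `J₀(v) = ½[v]² - (1/2_s^*)‖v‖_{2_s^*}^{2_s^*}` over `𝒩₀`. -/
def mJ0 (N : ℕ) (s : ℝ) : ℝ :=
  sInf {E : ℝ | ∃ v : RN N → ℝ, MemHs N s v ∧ v ≠ 0 ∧
    gagliardoSq N s v = lpPow N (critExp N s) v ∧
    E = (1 / 2) * gagliardoSq N s v - (1 / critExp N s) * lpPow N (critExp N s) v}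

/-- `m₀^*`: infimum of `I₀(v) = ½[v]² + ½‖v‖₂² - (1/2_s^*)‖v‖_{2_s^*}^{2_s^*}` over the
Nehari manifold `[v]² + ‖v‖₂² = ‖v‖_{2_s^*}^{2_s^*}`. -/
def m0crit (N : ℕ) (s : ℝ) : ℝ :=
  sInf {E : ℝ | ∃ v : RN N → ℝ, MemHs N s v ∧ v ≠ 0 ∧
    gagliardoSq N s v + lpPow N 2 v = lpPow N (critExp N s) v ∧
    E = (1 / 2) * gagliardoSq N s v + (1 / 2) * lpPow N 2 v
        - (1 / critExp N s) * lpPow N (critExp N s) v}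

/-- Infimum of `I_λ` over the Nehari manifold `[u]² + ‖u‖₂² = ‖u‖_p^p + λ‖u‖_q^q`
(subcritical setting); for `λ = 0` this is the Nehari level of the limit equation. -/
def mSub (N : ℕ) (s p q lam : ℝ) : ℝ :=
  sInf {E : ℝ | ∃ v : RN N → ℝ, MemHs N s v ∧ v ≠ 0 ∧
    gagliardoSq N s v + lpPow N 2 v = lpPow N p v + lam * lpPow N q v ∧
    E = energy N s p q lam v}

/-- `Q(q) = ((2_s^*-q)/(2_s^*-2))^{(2_s^*-q)/(q-2)}`. -/
def Qfun (N : ℕ) (s q : ℝ) : ℝ :=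
  ((critExp N s - q) / (critExp N s - 2)) ^ ((critExp N s - q) / (q - 2))

/-- `G(q) = ((q-2)/(2_s^*-2)) Q(q)`. -/
def Gfun (N : ℕ) (s q : ℝ) : ℝ := ((q - 2) / (critExp N s - 2)) * Qfun N s q

/-- The Gagliardo integrand. -/
def gagliardoKernel (N : ℕ) (s : ℝ) (v : RN N → ℝ) (x y : RN N) : ℝ :=
  (v x - v y) ^ 2 / ‖x - y‖ ^ ((N : ℝ) + 2 * s)

/-- The extended-real-valued squared Gagliardo seminorm. -/
def gagliardoLint (N : ℕ) (s : ℝ) (v : RN N → ℝ) : ENNReal :=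
  ∫⁻ z : RN N × RN N, ENNReal.ofReal (gagliardoKernel N s v z.1 z.2)

lemma gagliardoKernel_nonneg (N : ℕ) (s : ℝ) (v : RN N → ℝ) (x y : RN N) :
    0 ≤ gagliardoKernel N s v x y := by
  unfold gagliardoKernel; positivity

lemma measurable_gagliardoKernel {N : ℕ} (s : ℝ) {v : RN N → ℝ} (hv : Measurable v) :
    Measurable (fun z : RN N × RN N => gagliardoKernel N s v z.1 z.2) := by
  unfold gagliardoKernel
  fun_prop

lemma MemHs.gagliardoLint_eq {N : ℕ} {s : ℝ} {v : RN N → ℝ} (h : MemHs N s v) :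
    gagliardoLint N s v = ENNReal.ofReal (gagliardoSq N s v) :=
  (ofReal_integral_eq_lintegral_ofReal h.2
    (ae_of_all _ fun z => gagliardoKernel_nonneg N s v z.1 z.2)).symm

lemma gagliardoSq_nonneg (N : ℕ) (s : ℝ) (v : RN N → ℝ) : 0 ≤ gagliardoSq N s v :=
  integral_nonneg fun z => gagliardoKernel_nonneg N s v z.1 z.2

lemma gagliardoLint_eq_iterated {N : ℕ} (s : ℝ) {v : RN N → ℝ} (hv : Measurable v) :
    gagliardoLint N s v = ∫⁻ x, ∫⁻ y, ENNReal.ofReal (gagliardoKernel N s v x y) := by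
  unfold gagliardoLint
  rw [Measure.volume_eq_prod,
    lintegral_prod _ (measurable_gagliardoKernel s hv).ennreal_ofReal.aemeasurable]

lemma volume_ball_eq {N : ℕ} [Nontrivial (RN N)] (x : RN N) {r : ℝ} (hr : 0 ≤ r) :
    volume (Metric.ball x r) =
      ENNReal.ofReal ((volume (Metric.ball (0 : RN N) 1)).toReal * r ^ N) := by
  rw [Measure.addHaar_ball _ _ hr, finrank_euclideanSpace_fin, mul_comm,
    ENNReal.ofReal_mul ENNReal.toReal_nonneg, ENNReal.ofReal_toReal measure_ball_lt_top.ne]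

lemma toReal_volume_ball_pos (N : ℕ) : 0 < (volume (Metric.ball (0 : RN N) 1)).toReal :=
  ENNReal.toReal_pos (Metric.measure_ball_pos _ _ one_pos).ne' measure_ball_lt_top.ne

/-- Pointwise form of the fractional Sobolev inequality. -/
lemma exists_rpow_critExp_le_lintegral_kernel {N : ℕ} {s : ℝ} (hs : 0 < s)
    (hN : 2 * s < (N : ℝ)) :
    ∃ C : ℝ, 0 < C ∧ ∀ v : RN N → ℝ, Measurable v → ∀ I : ℝ, 0 < I →
      ∫⁻ y, ENNReal.ofReal (|v y| ^ critExp N s) ≤ ENNReal.ofReal I → ∀ x,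
      ENNReal.ofReal (|v x| ^ critExp N s) ≤ ENNReal.ofReal (C * I ^ (2 * s / N)) *
        ∫⁻ y, ENNReal.ofReal (gagliardoKernel N s v x y) := by
  have hN0 : (0 : ℝ) < N := by linarith
  have hNn : 0 < N := by exact_mod_cast hN0
  have : Nonempty (Fin N) := ⟨⟨0, hNn⟩⟩
  have hd : 0 < (N : ℝ) - 2 * s := by linarith
  set P := critExp N s with hP
  have hP2 : 0 < P := by rw [hP]; unfold critExp; positivity
  set c := (volume (Metric.ball (0 : RN N) 1)).toReal with hc
  have hcpos : 0 < c := toReal_volume_ball_pos N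
  set K : ℝ := 2 ^ (P + 1) / c with hK
  have hKpos : 0 < K := by positivity
  refine ⟨8 / c * K ^ (2 * s / N), by positivity, fun v hv I hI hvI x => ?_⟩
  rcases eq_or_ne (v x) 0 with h0 | h0
  · simp [h0, Real.zero_rpow hP2.ne']
  set a := |v x| with ha
  have hapos : 0 < a := abs_pos.mpr h0
  set r : ℝ := (K * I * a ^ (-P)) ^ (1 / (N : ℝ)) with hr
  have hrpos : 0 < r := by positivity
  have hrN : r ^ N = K * I * a ^ (-P) := by
    rw [hr, ← Real.rpow_natCast, ← Real.rpow_mul (by positivity)]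
    field_simp
    simp
  have hr2s : r ^ (2 * s) = (K * I * a ^ (-P)) ^ (2 * s / N) := by
    rw [hr, ← Real.rpow_mul (by positivity)]
    congr 1; field_simp
  -- the superlevel set
  set T := {y | ENNReal.ofReal ((a / 2) ^ P) ≤ ENNReal.ofReal (|v y| ^ P)} with hT
  have hTm : MeasurableSet T := measurableSet_le measurable_const
    (by fun_prop)
  have hTvol : volume T ≤ ENNReal.ofReal (c * r ^ N / 2) := by
    have h1 := meas_ge_le_lintegral_div (μ := (volume : Measure (RN N)))
      (f := fun y => ENNReal.ofReal (|v y| ^ P)) (by fun_prop)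
      (ε := ENNReal.ofReal ((a / 2) ^ P)) (by simp; positivity) ENNReal.ofReal_ne_top
    refine h1.trans ((ENNReal.div_le_div_right hvI _).trans ?_)
    rw [← ENNReal.ofReal_div_of_pos (by positivity)]
    apply ENNReal.ofReal_le_ofReal
    rw [hrN, hK, Real.div_rpow hapos.le zero_le_two, Real.rpow_add two_pos, Real.rpow_neg hapos.le]
    apply le_of_eq
    field_simp
    norm_num
  set S := Metric.ball x r \ T with hS
  have hSm : MeasurableSet S := Metric.isOpen_ball.measurableSet.diff hTm
  have hSvol : ENNReal.ofReal (c * r ^ N / 2) ≤ volume S := by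
    have h2 : volume (Metric.ball x r) - volume T ≤ volume S := le_measure_sdiff
    refine le_trans ?_ h2
    rw [volume_ball_eq x hrpos.le]
    refine le_trans ?_ (tsub_le_tsub_left hTvol _)
    rw [← ENNReal.ofReal_sub _ (by positivity)]
    apply ENNReal.ofReal_le_ofReal
    linarith
  have hker : ∀ y ∈ S, a ^ 2 / 4 / r ^ ((N : ℝ) + 2 * s) ≤ gagliardoKernel N s v x y := by
    rintro y ⟨hy, hyT⟩
    have hlt : |v y| < a / 2 := by
      by_contra hcon
      push Not at hcon
      exact hyT (ENNReal.ofReal_le_ofReal (Real.rpow_le_rpow (by positivity) hcon hP2.le))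
    have hxy : ‖x - y‖ < r := by
      rw [Metric.mem_ball, dist_eq_norm, norm_sub_rev] at hy; exact hy
    have hne : 0 < ‖x - y‖ := by
      rw [norm_pos_iff, sub_ne_zero]
      rintro rfl
      linarith
    unfold gagliardoKernel
    have hsq : a ^ 2 / 4 ≤ (v x - v y) ^ 2 := by
      have h3 : a / 2 ≤ |v x - v y| := by
        have := abs_sub_abs_le_abs_sub (v x) (v y)
        linarith
      rw [← sq_abs (v x - v y)]
      nlinarith
    gcongr
  have hint : ENNReal.ofReal (c / 8 * a ^ 2 * (r ^ (2 * s))⁻¹) ≤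
      ∫⁻ y, ENNReal.ofReal (gagliardoKernel N s v x y) := by
    calc ENNReal.ofReal (c / 8 * a ^ 2 * (r ^ (2 * s))⁻¹)
        = ENNReal.ofReal (a ^ 2 / 4 / r ^ ((N : ℝ) + 2 * s)) * ENNReal.ofReal (c * r ^ N / 2) := by
          rw [← ENNReal.ofReal_mul (by positivity), Real.rpow_add hrpos, Real.rpow_natCast]
          congr 1
          field_simp
          norm_num
      _ ≤ ENNReal.ofReal (a ^ 2 / 4 / r ^ ((N : ℝ) + 2 * s)) * volume S := by gcongr
      _ = ∫⁻ _ in S, ENNReal.ofReal (a ^ 2 / 4 / r ^ ((N : ℝ) + 2 * s)) := by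
          rw [setLIntegral_const]
      _ ≤ ∫⁻ y in S, ENNReal.ofReal (gagliardoKernel N s v x y) :=
          setLIntegral_mono' hSm fun y hy => ENNReal.ofReal_le_ofReal (hker y hy)
      _ ≤ _ := setLIntegral_le_lintegral _ _
  refine le_trans (le_of_eq ?_) (mul_le_mul_right hint _)
  rw [← ENNReal.ofReal_mul (by positivity)]
  congr 1
  rw [hr2s, Real.mul_rpow (by positivity) (by positivity), Real.mul_rpow hKpos.le hI.le,
    ← Real.rpow_mul hapos.le]
  have hexp : a ^ P = a ^ 2 * (a ^ (-P * (2 * s / N)))⁻¹ := by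
    rw [← Real.rpow_neg hapos.le, ← Real.rpow_natCast, ← Real.rpow_add hapos]
    congr 1
    rw [hP]; unfold critExp; push_cast; field_simp; ring
  rw [hexp]
  field_simp

lemma critExp_gt_two {N : ℕ} {s : ℝ} (hs : 0 < s) (hN : 2 * s < (N : ℝ)) : 2 < critExp N s := by
  have hd : 0 < (N : ℝ) - 2 * s := by linarith
  unfold critExp
  rw [lt_div_iff₀ hd]
  linarith

lemma exists_lintegral_rpow_critExp_le_of_ne_top {N : ℕ} {s : ℝ} (hs : 0 < s)
    (hN : 2 * s < (N : ℝ)) :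
    ∃ C : ℝ, 0 < C ∧ ∀ v : RN N → ℝ, Measurable v →
      ∫⁻ y, ENNReal.ofReal (|v y| ^ critExp N s) ≠ ⊤ → ∀ G : ℝ, 0 ≤ G →
      gagliardoLint N s v ≤ ENNReal.ofReal G →
      ∫⁻ y, ENNReal.ofReal (|v y| ^ critExp N s) ≤
        ENNReal.ofReal ((C * G) ^ (critExp N s / 2)) := by
  obtain ⟨C, hC, H⟩ := exists_rpow_critExp_le_lintegral_kernel hs hN
  refine ⟨C, hC, fun v hv hfin G hG hvG => ?_⟩
  have hN0 : (0 : ℝ) < N := by linarith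
  have hd : 0 < (N : ℝ) - 2 * s := by linarith
  have hP2 := critExp_gt_two hs hN
  obtain ⟨I, hI⟩ : ∃ I, I = (∫⁻ y, ENNReal.ofReal (|v y| ^ critExp N s)).toReal := ⟨_, rfl⟩
  have hIe : ∫⁻ y, ENNReal.ofReal (|v y| ^ critExp N s) = ENNReal.ofReal I := by
    rw [hI, ENNReal.ofReal_toReal hfin]
  have hI0 : 0 ≤ I := hI ▸ ENNReal.toReal_nonneg
  rw [hIe]
  apply ENNReal.ofReal_le_ofReal
  rcases hI0.eq_or_lt with h0 | hpos
  · rw [← h0]; positivity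
  have h1 := H v hv I hpos hIe.le
  have h2 : ENNReal.ofReal I ≤ ENNReal.ofReal (C * I ^ (2 * s / N) * G) := by
    rw [← hIe, ENNReal.ofReal_mul (by positivity)]
    calc _ ≤ ∫⁻ x, ENNReal.ofReal (C * I ^ (2 * s / N)) *
          ∫⁻ y, ENNReal.ofReal (gagliardoKernel N s v x y) := lintegral_mono h1
      _ = ENNReal.ofReal (C * I ^ (2 * s / N)) * gagliardoLint N s v := by
          rw [lintegral_const_mul' _ _ ENNReal.ofReal_ne_top, gagliardoLint_eq_iterated s hv]
      _ ≤ _ := by gcongr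
  rw [ENNReal.ofReal_le_ofReal_iff (by positivity)] at h2
  have h3 : I ^ (2 / critExp N s) ≤ C * G := by
    have h4 : I = I ^ (2 / critExp N s) * I ^ (2 * s / N) := by
      rw [← Real.rpow_add hpos]
      conv_lhs => rw [← Real.rpow_one I]
      congr 1
      unfold critExp; field_simp; ring
    have h5 : 0 < I ^ (2 * s / N) := by positivity
    refine le_of_mul_le_mul_right ?_ h5
    rw [← h4]; linarith
  calc I = (I ^ (2 / critExp N s)) ^ (critExp N s / 2) := by
        rw [← Real.rpow_mul hI0]
        have : 2 / critExp N s * (critExp N s / 2) = 1 := by field_simp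
        rw [this, Real.rpow_one]
    _ ≤ _ := Real.rpow_le_rpow (by positivity) h3 (by positivity)

/-- The fractional Sobolev inequality. -/
lemma exists_sobolev {N : ℕ} {s : ℝ} (hs : 0 < s) (hN : 2 * s < (N : ℝ)) :
    ∃ C : ℝ, 0 < C ∧ ∀ v : RN N → ℝ, Measurable v → MemHs N s v →
      Integrable (fun x => |v x| ^ critExp N s) ∧
      (∫ x, |v x| ^ critExp N s) ^ (2 / critExp N s) ≤ C * gagliardoSq N s v := by
  obtain ⟨C, hC, H⟩ := exists_lintegral_rpow_critExp_le_of_ne_top hs hN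
  have hP2 := critExp_gt_two hs hN
  refine ⟨C, hC, fun v hv hvH => ?_⟩
  have hG := gagliardoSq_nonneg N s v
  set G := gagliardoSq N s v
  set P := critExp N s
  let w : ℕ → RN N → ℝ := fun n x => max (-(n : ℝ)) (min (v x) n)
  have hwm : ∀ n, Measurable (w n) := fun n => by
    exact measurable_const.max (hv.min measurable_const)
  have hwb : ∀ n x, |w n x| ≤ n := fun n x => by
    have : (0 : ℝ) ≤ n := n.cast_nonneg
    rw [abs_le]
    exact ⟨le_max_left _ _, max_le (by linarith) (min_le_right _ _)⟩
  have hwv : ∀ n x, |w n x| ≤ |v x| := fun n x => by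
    have : (0 : ℝ) ≤ n := n.cast_nonneg
    simp only [w]
    rcases le_total (v x) n with h1 | h1
    · rw [min_eq_left h1]
      rcases le_total (-(n : ℝ)) (v x) with h2 | h2
      · rw [max_eq_right h2]
      · rw [max_eq_left h2, abs_neg, abs_of_nonneg this, abs_of_nonpos (by linarith)]; linarith
    · rw [min_eq_right h1, max_eq_right (by linarith), abs_of_nonneg this,
        abs_of_nonneg (by linarith)]; exact h1
  have hwd : ∀ n x y, |w n x - w n y| ≤ |v x - v y| := fun n x y => by
    simp only [w]
    calc _ ≤ max |-(n : ℝ) - -(n : ℝ)| |min (v x) n - min (v y) n| := abs_max_sub_max_le_max _ _ _ _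
      _ = |min (v x) n - min (v y) n| := by simp
      _ ≤ max |v x - v y| |(n : ℝ) - n| := abs_min_sub_min_le_max _ _ _ _
      _ = |v x - v y| := by simp
  have hfin : ∀ n, ∫⁻ y, ENNReal.ofReal (|w n y| ^ P) ≠ ⊤ := fun n => by
    refine ne_top_of_le_ne_top (b := ∫⁻ y, ENNReal.ofReal ((n : ℝ) ^ (P - 2) * v y ^ 2)) ?_ ?_
    · exact ((hasFiniteIntegral_iff_ofReal (ae_of_all _ fun y => by positivity)).1
        (hvH.1.const_mul ((n : ℝ) ^ (P - 2))).2).ne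
    · refine lintegral_mono fun y => ENNReal.ofReal_le_ofReal ?_
      have : |w n y| ^ P = |w n y| ^ (P - 2) * |w n y| ^ 2 := by
        rw [← Real.rpow_natCast, ← Real.rpow_add_of_nonneg (abs_nonneg _) (by linarith)
          (by norm_num)]
        congr 1; push_cast; ring
      rw [this, ← sq_abs (v y)]
      exact mul_le_mul (Real.rpow_le_rpow (abs_nonneg _) (hwb n y) (by linarith))
        (pow_le_pow_left₀ (abs_nonneg _) (hwv n y) 2) (by positivity) (by positivity)
  have hGn : ∀ n, gagliardoLint N s (w n) ≤ ENNReal.ofReal G := fun n => by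
    rw [← hvH.gagliardoLint_eq]
    refine lintegral_mono fun z => ENNReal.ofReal_le_ofReal ?_
    unfold gagliardoKernel
    gcongr ?_ / _
    exact sq_le_sq.2 (hwd n _ _)
  have hbd := fun n => H (w n) (hwm n) (hfin n) G hG (hGn n)
  have hlim : ∀ x, liminf (fun n => ENNReal.ofReal (|w n x| ^ P)) atTop =
      ENNReal.ofReal (|v x| ^ P) := fun x => by
    apply Tendsto.liminf_eq
    apply tendsto_const_nhds.congr'
    obtain ⟨n₀, hn₀⟩ := exists_nat_ge |v x|
    filter_upwards [eventually_ge_atTop n₀] with n hn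
    have h1 : |v x| ≤ n := hn₀.trans (by exact_mod_cast hn)
    have h2 := abs_le.1 h1
    simp only [w]
    rw [min_eq_left h2.2, max_eq_right h2.1]
  have hfatou : ∫⁻ x, ENNReal.ofReal (|v x| ^ P) ≤ ENNReal.ofReal ((C * G) ^ (P / 2)) := by
    calc ∫⁻ x, ENNReal.ofReal (|v x| ^ P)
        = ∫⁻ x, liminf (fun n => ENNReal.ofReal (|w n x| ^ P)) atTop := by simp_rw [hlim]
      _ ≤ liminf (fun n => ∫⁻ x, ENNReal.ofReal (|w n x| ^ P)) atTop :=
          lintegral_liminf_le fun n => by have := hwm n; fun_prop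
      _ ≤ _ := by
          refine (liminf_le_liminf (Eventually.of_forall hbd)).trans ?_
          simp
  have hint : Integrable (fun x => |v x| ^ P) := by
    refine ⟨(hv.abs.pow_const P).aestronglyMeasurable, ?_⟩
    rw [hasFiniteIntegral_iff_ofReal (ae_of_all _ fun y => by positivity)]
    exact hfatou.trans_lt ENNReal.ofReal_lt_top
  refine ⟨hint, ?_⟩
  rw [← ofReal_integral_eq_lintegral_ofReal hint (ae_of_all _ fun y => by positivity),
    ENNReal.ofReal_le_ofReal_iff (by positivity)] at hfatou
  calc (∫ x, |v x| ^ P) ^ (2 / P) ≤ ((C * G) ^ (P / 2)) ^ (2 / P) :=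
        Real.rpow_le_rpow (integral_nonneg fun y => by positivity) hfatou (by positivity)
    _ = C * G := by
        rw [← Real.rpow_mul (by positivity)]
        have : P / 2 * (2 / P) = 1 := by field_simp
        rw [this, Real.rpow_one]

lemma integral_comp_smul_RN {N : ℕ} (f : RN N → ℝ) {μ : ℝ} (hμ : 0 < μ) :
    ∫ x, f (μ • x) = (μ ^ N)⁻¹ * ∫ x, f x := by
  rw [Measure.integral_comp_smul, finrank_euclideanSpace_fin, abs_of_pos (by positivity),
    smul_eq_mul]

lemma lintegral_comp_smul_le {N : ℕ} {f : RN N → ENNReal} (hf : Measurable f) {μ : ℝ}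
    (hμ : 1 ≤ μ) : ∫⁻ x, f (μ • x) ≤ ∫⁻ x, f x := by
  have hμ0 : 0 < μ := by linarith
  rw [← lintegral_map hf (measurable_const_smul μ), Measure.map_addHaar_smul _ hμ0.ne',
    lintegral_smul_measure, finrank_euclideanSpace_fin, smul_eq_mul]
  refine mul_le_of_le_one_left' ?_
  rw [ENNReal.ofReal_le_one, abs_of_pos (by positivity)]
  exact inv_le_one_of_one_le₀ (one_le_pow₀ hμ)

/-- Form-boundedness of the dilated potentials `u (μ • x) ^ r`, uniform in `μ ≥ 1`, with
arbitrarily small constant up to a local `L²` term. -/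
lemma exists_integral_potential_le {N : ℕ} {s : ℝ} (hs : 0 < s) (hN : 2 * s < (N : ℝ))
    {u : RN N → ℝ} (hu : Measurable u) (huH : MemHs N s u) (hu0 : ∀ x, 0 ≤ u x)
    {r : ℝ} (hr : 0 < r) (hrP : r ≤ critExp N s - 2) {ε : ℝ} (hε : 0 < ε) :
    ∃ C R : ℝ, 0 ≤ C ∧ 0 < R ∧ ∀ μ : ℝ, 1 ≤ μ → ∀ v : RN N → ℝ, Measurable v → MemHs N s v →
      Integrable (fun x => u (μ • x) ^ r * v x ^ 2) ∧
      ∫ x, u (μ • x) ^ r * v x ^ 2 ≤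
        ε * (gagliardoSq N s v + ∫ x, v x ^ 2) + C * ∫ x in Metric.ball 0 R, v x ^ 2 := by
  obtain ⟨S, hS, HS⟩ := exists_sobolev hs hN
  have hP2 := critExp_gt_two hs hN
  have huP := (HS u hu huH).1
  set P := critExp N s
  obtain ⟨β, hβ⟩ : ∃ β, β = P - 2 := ⟨_, rfl⟩
  have hβ0 : 0 < β := by linarith
  have hrβ : r ≤ β := by linarith
  obtain ⟨C', hC', hpt⟩ : ∃ C' : ℝ, 0 < C' ∧ ∀ a : ℝ, 0 ≤ a → a ^ r ≤ ε + C' * a ^ β := by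
    refine ⟨(ε ^ (1 / r)) ^ (r - β), by positivity, fun a ha => ?_⟩
    have hδ : 0 < ε ^ (1 / r) := by positivity
    rcases le_total a (ε ^ (1 / r)) with h | h
    · have h1 : a ^ r ≤ (ε ^ (1 / r)) ^ r := Real.rpow_le_rpow ha h hr.le
      rw [← Real.rpow_mul hε.le, one_div_mul_cancel hr.ne', Real.rpow_one] at h1
      have : 0 ≤ (ε ^ (1 / r)) ^ (r - β) * a ^ β := by positivity
      linarith
    · have ha0 : 0 < a := hδ.trans_le h
      have h1 : a ^ r = a ^ (r - β) * a ^ β := by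
        rw [← Real.rpow_add ha0]; congr 1; ring
      have h2 : a ^ (r - β) ≤ (ε ^ (1 / r)) ^ (r - β) :=
        Real.rpow_le_rpow_of_nonpos hδ h (by linarith)
      rw [h1]
      have := mul_le_mul_of_nonneg_right h2 (Real.rpow_nonneg ha β)
      linarith
  set η : ℝ := (ε / (C' * S)) ^ (P / β) with hη
  have hη0 : 0 < η := by positivity
  let T : ℕ → Set (RN N) := fun n => {x | (n : ℝ) + 1 ≤ ‖x‖ ∨ (n : ℝ) + 1 ≤ u x}
  have hTm : ∀ n, MeasurableSet (T n) := fun n =>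
    (measurableSet_le measurable_const measurable_norm).union (measurableSet_le measurable_const hu)
  have hTanti : Antitone T := fun m n hmn x hx => by
    have : (m : ℝ) ≤ n := by exact_mod_cast hmn
    exact hx.imp (fun h => by linarith) (fun h => by linarith)
  have hTinter : ⋂ n, T n = ∅ := by
    ext x
    simp only [mem_iInter, mem_empty_iff_false, iff_false, not_forall]
    obtain ⟨n, hn⟩ := exists_nat_ge (max ‖x‖ (u x))
    refine ⟨n, ?_⟩
    have h1 := (le_max_left _ _).trans hn
    have h2 := (le_max_right _ _).trans hn
    rintro (h | h) <;> linarith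
  have hlim := tendsto_setIntegral_of_antitone (f := fun x => |u x| ^ P) (μ := volume) hTm hTanti
    ⟨0, huP.integrableOn⟩
  rw [hTinter, setIntegral_empty] at hlim
  obtain ⟨n, hn⟩ := (hlim.eventually (gt_mem_nhds hη0)).exists
  set R : ℝ := (n : ℝ) + 1 with hR
  have hR0 : 0 < R := by positivity
  refine ⟨C' * R ^ β, R, by positivity, hR0, fun μ hμ v hv hvH => ?_⟩
  have hμ0 : 0 < μ := by linarith
  have hvP := HS v hv hvH
  set F : RN N → ℝ := (T n).indicator (fun x => u x ^ β) with hF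
  have hFm : Measurable F := (hu.pow_const β).indicator (hTm n)
  have hF0 : ∀ x, 0 ≤ F x := fun x => indicator_nonneg (fun x _ => by have := hu0 x; positivity) x
  have hFpow : (fun x => F x ^ (P / β)) = (T n).indicator (fun x => |u x| ^ P) := by
    ext x
    by_cases hx : x ∈ T n
    · simp only [hF, indicator_of_mem hx]
      rw [← Real.rpow_mul (hu0 x), abs_of_nonneg (hu0 x)]
      congr 1; field_simp
    · simp only [hF, indicator_of_notMem hx]
      rw [Real.zero_rpow (by positivity)]
  have hFint : Integrable (fun x => F x ^ (P / β)) := by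
    rw [hFpow]; exact huP.indicator (hTm n)
  have hFval : ∫ x, F (μ • x) ^ (P / β) ≤ η := by
    rw [integral_comp_smul_RN (fun x => F x ^ (P / β)) hμ0, hFpow, integral_indicator (hTm n)]
    have h1 : (μ ^ N)⁻¹ ≤ 1 := inv_le_one_of_one_le₀ (one_le_pow₀ hμ)
    have h2 : 0 ≤ ∫ x in T n, |u x| ^ P := integral_nonneg fun x => by positivity
    calc _ ≤ 1 * ∫ x in T n, |u x| ^ P := mul_le_mul_of_nonneg_right h1 h2
      _ ≤ η := by rw [one_mul]; exact hn.le
  have hFμm : Measurable (fun x => F (μ • x)) := hFm.comp (measurable_const_smul μ)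
  have hFμL : MemLp (fun x => F (μ • x)) (ENNReal.ofReal (P / β)) := by
    rw [← integrable_norm_rpow_iff hFμm.aestronglyMeasurable
      (by simp; positivity) ENNReal.ofReal_ne_top, ENNReal.toReal_ofReal (by positivity)]
    have := hFint.comp_smul hμ0.ne'
    refine this.congr (ae_of_all _ fun x => ?_)
    simp only [Real.norm_of_nonneg (hF0 _)]
  have hvsq : ∀ x, (v x ^ 2) ^ (P / 2) = |v x| ^ P := fun x => by
    rw [← sq_abs, ← Real.rpow_natCast, ← Real.rpow_mul (abs_nonneg _)]
    congr 1; push_cast; field_simp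
  have hvL : MemLp (fun x => v x ^ 2) (ENNReal.ofReal (P / 2)) := by
    rw [← integrable_norm_rpow_iff (hv.pow_const 2).aestronglyMeasurable
      (by simp; linarith) ENNReal.ofReal_ne_top, ENNReal.toReal_ofReal (by positivity)]
    refine hvP.1.congr (ae_of_all _ fun x => ?_)
    simp only [Real.norm_of_nonneg (sq_nonneg _), hvsq]
  have hconj : (P / β).HolderConjugate (P / 2) := by
    rw [Real.holderConjugate_iff]
    refine ⟨by rw [lt_div_iff₀ hβ0]; linarith, ?_⟩
    have : P ≠ 0 := by linarith
    field_simp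
    linarith
  have hFv : Integrable (fun x => F (μ • x) * v x ^ 2) := by
    have h1 := (hFint.comp_smul hμ0.ne').add hvP.1
    refine h1.mono' (hFμm.mul (hv.pow_const 2)).aestronglyMeasurable (ae_of_all _ fun x => ?_)
    have h2 := Real.young_inequality_of_nonneg (hF0 (μ • x)) (sq_nonneg (v x)) hconj
    have h3 : 0 ≤ F (μ • x) ^ (P / β) := Real.rpow_nonneg (hF0 _) _
    have h4 : 0 ≤ |v x| ^ P := by positivity
    rw [Real.norm_of_nonneg (mul_nonneg (hF0 _) (sq_nonneg _))]
    rw [hvsq] at h2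
    have h5 := div_le_self h3 hconj.lt.le
    have h6 := div_le_self h4 hconj.symm.lt.le
    simp only [Pi.add_apply]
    linarith
  have hHolder : ∫ x, F (μ • x) * v x ^ 2 ≤ ε / C' * gagliardoSq N s v := by
    refine (integral_mul_le_Lp_mul_Lq_of_nonneg hconj (ae_of_all _ fun x => hF0 _)
      (ae_of_all _ fun x => sq_nonneg _) hFμL hvL).trans ?_
    simp only [hvsq]
    have h1 : (∫ x, F (μ • x) ^ (P / β)) ^ (1 / (P / β)) ≤ ε / (C' * S) := by
      refine (Real.rpow_le_rpow (integral_nonneg fun x => Real.rpow_nonneg (hF0 _) _) hFval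
        (by positivity)).trans (le_of_eq ?_)
      rw [hη, ← Real.rpow_mul (by positivity)]
      have : P / β * (1 / (P / β)) = 1 := by field_simp
      rw [this, Real.rpow_one]
    have h2 : (∫ x, |v x| ^ P) ^ (1 / (P / 2)) ≤ S * gagliardoSq N s v := by
      rw [one_div_div]; exact hvP.2
    refine (mul_le_mul h1 h2 (Real.rpow_nonneg (integral_nonneg fun x => by positivity) _)
      (by positivity)).trans (le_of_eq ?_)
    field_simp
  have hBint : Integrable ((Metric.ball (0 : RN N) R).indicator fun x => v x ^ 2) :=
    hvH.1.indicator Metric.isOpen_ball.measurableSet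
  have hbound : ∀ x, u (μ • x) ^ r * v x ^ 2 ≤ ε * v x ^ 2 +
      C' * R ^ β * (Metric.ball (0 : RN N) R).indicator (fun x => v x ^ 2) x +
      C' * (F (μ • x) * v x ^ 2) := fun x => by
    have h1 := mul_le_mul_of_nonneg_right (hpt _ (hu0 (μ • x))) (sq_nonneg (v x))
    refine h1.trans ?_
    have hsq := sq_nonneg (v x)
    have h2 : u (μ • x) ^ β * v x ^ 2 ≤
        R ^ β * (Metric.ball (0 : RN N) R).indicator (fun x => v x ^ 2) x +
          F (μ • x) * v x ^ 2 := by
      by_cases hx : μ • x ∈ T n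
      · have h3 : F (μ • x) = u (μ • x) ^ β := indicator_of_mem hx _
        have h4 : 0 ≤ (Metric.ball (0 : RN N) R).indicator (fun x => v x ^ 2) x :=
          indicator_nonneg (fun x _ => sq_nonneg _) x
        rw [h3]
        have : 0 ≤ R ^ β * (Metric.ball (0 : RN N) R).indicator (fun x => v x ^ 2) x := by
          positivity
        linarith
      · have h3 : F (μ • x) = 0 := indicator_of_notMem hx _
        have h4 : ¬ (R ≤ ‖μ • x‖ ∨ R ≤ u (μ • x)) := hx
        push Not at h4
        have h5 : x ∈ Metric.ball (0 : RN N) R := by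
          rw [mem_ball_zero_iff]
          refine lt_of_le_of_lt ?_ h4.1
          rw [norm_smul, Real.norm_of_nonneg hμ0.le]
          exact le_mul_of_one_le_left (norm_nonneg _) hμ
        rw [h3, indicator_of_mem h5, zero_mul, add_zero]
        exact mul_le_mul_of_nonneg_right (Real.rpow_le_rpow (hu0 _) h4.2.le hβ0.le) hsq
    nlinarith [mul_le_mul_of_nonneg_left h2 hC'.le]
  have hdom : Integrable (fun x => ε * v x ^ 2 +
      C' * R ^ β * (Metric.ball (0 : RN N) R).indicator (fun x => v x ^ 2) x +
      C' * (F (μ • x) * v x ^ 2)) :=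
    ((hvH.1.const_mul ε).add (hBint.const_mul _)).add (hFv.const_mul _)
  have humeas : Measurable (fun x => u (μ • x) ^ r * v x ^ 2) :=
    ((hu.comp (measurable_const_smul μ)).pow_const r).mul (hv.pow_const 2)
  have hint : Integrable (fun x => u (μ • x) ^ r * v x ^ 2) := by
    refine hdom.mono' humeas.aestronglyMeasurable (ae_of_all _ fun x => ?_)
    rw [Real.norm_of_nonneg (mul_nonneg (Real.rpow_nonneg (hu0 _) _) (sq_nonneg _))]
    exact hbound x
  refine ⟨hint, (integral_mono hint hdom hbound).trans ?_⟩
  have hsum : Integrable (fun x => ε * v x ^ 2 +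
      C' * R ^ β * (Metric.ball (0 : RN N) R).indicator (fun x => v x ^ 2) x) :=
    (hvH.1.const_mul ε).add (hBint.const_mul _)
  rw [integral_add hsum (hFv.const_mul _),
    integral_add (hvH.1.const_mul ε) (hBint.const_mul _), integral_const_mul, integral_const_mul,
    integral_const_mul, integral_indicator Metric.isOpen_ball.measurableSet]
  have h7 := mul_le_mul_of_nonneg_left hHolder hC'.le
  have h8 : C' * (ε / C' * gagliardoSq N s v) = ε * gagliardoSq N s v := by field_simp
  linarith

lemma lintegral_ball_sq_sub_le {N : ℕ} {s : ℝ} (hs : 0 < s) (v : RN N → ℝ) (x : RN N) {ρ : ℝ}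
    (hρ : 0 < ρ) :
    ∫⁻ y in Metric.ball x ρ, ENNReal.ofReal ((v x - v y) ^ 2) ≤
      ENNReal.ofReal (ρ ^ ((N : ℝ) + 2 * s)) *
        ∫⁻ y, ENNReal.ofReal (gagliardoKernel N s v x y) := by
  have hκ : 0 < (N : ℝ) + 2 * s := by positivity
  rw [← lintegral_const_mul' _ _ ENNReal.ofReal_ne_top]
  refine (setLIntegral_mono' Metric.isOpen_ball.measurableSet fun y hy => ?_).trans
    (setLIntegral_le_lintegral _ _)
  rw [← ENNReal.ofReal_mul (by positivity)]
  apply ENNReal.ofReal_le_ofReal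
  rcases eq_or_ne x y with rfl | hxy
  · simp [gagliardoKernel]
  · have h1 : 0 < ‖x - y‖ := norm_pos_iff.2 (sub_ne_zero.2 hxy)
    have h2 : ‖x - y‖ ≤ ρ := by
      rw [Metric.mem_ball, dist_eq_norm, norm_sub_rev] at hy; exact hy.le
    have h3 := Real.rpow_le_rpow h1.le h2 hκ.le
    unfold gagliardoKernel
    rw [mul_div_assoc', le_div_iff₀ (by positivity), mul_comm]
    exact mul_le_mul_of_nonneg_right h3 (sq_nonneg _)

/-- Local `L²` modulus of continuity of dilations on `H^s`. -/
lemma exists_integral_ball_dilation_sub_sq_le {N : ℕ} {s : ℝ} (hs : 0 < s)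
    (hN : 2 * s < (N : ℝ)) {R : ℝ} (hR : 0 < R) :
    ∃ C : ℝ, 0 ≤ C ∧ ∀ t : ℝ, 0 < t → t ≤ 1 → ∀ v : RN N → ℝ, Measurable v → MemHs N s v →
      ∫ x in Metric.ball 0 R, (v (Real.exp t • x) - v x) ^ 2 ≤
        C * t ^ (2 * s) * gagliardoSq N s v := by
  have hN0 : (0 : ℝ) < N := by linarith
  have hNn : 0 < N := by exact_mod_cast hN0
  have : Nonempty (Fin N) := ⟨⟨0, hNn⟩⟩
  set c := (volume (Metric.ball (0 : RN N) 1)).toReal with hc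
  have hcpos : 0 < c := toReal_volume_ball_pos N
  set κ : ℝ := (N : ℝ) + 2 * s with hκ
  refine ⟨2 * (2 ^ κ + 1) / c * (2 * R) ^ (2 * s), by positivity, fun t ht0 ht1 v hv hvH => ?_⟩
  set ρ : ℝ := 2 * t * R with hρ
  have hρ0 : 0 < ρ := by positivity
  set μ := Real.exp t with hμ
  have hμ1 : 1 ≤ μ := Real.one_le_exp ht0.le
  have hμt : μ - 1 ≤ 2 * t := by
    have := Real.abs_exp_sub_one_le (x := t) (by rw [abs_of_pos ht0]; exact ht1)
    rw [abs_of_pos ht0] at this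
    exact (le_abs_self _).trans this
  set g : RN N → ENNReal := fun x => ∫⁻ y, ENNReal.ofReal (gagliardoKernel N s v x y) with hg
  have hgm : Measurable g :=
    Measurable.lintegral_prod_right' (measurable_gagliardoKernel s hv).ennreal_ofReal
  have hgint : ∫⁻ x, g x = ENNReal.ofReal (gagliardoSq N s v) := by
    rw [← hvH.gagliardoLint_eq, gagliardoLint_eq_iterated s hv]
  have hpt : ∀ x ∈ Metric.ball (0 : RN N) R,
      ENNReal.ofReal (c * ρ ^ N) * ENNReal.ofReal ((v (μ • x) - v x) ^ 2) ≤
        ENNReal.ofReal (2 * (2 * ρ) ^ κ) * g (μ • x) + ENNReal.ofReal (2 * ρ ^ κ) * g x := by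
    intro x hx
    rw [mem_ball_zero_iff] at hx
    have hdist : dist x (μ • x) ≤ ρ := by
      have : x - μ • x = -((μ - 1) • x) := by rw [sub_smul, one_smul]; abel
      rw [dist_eq_norm, this, norm_neg, norm_smul, Real.norm_of_nonneg (by linarith)]
      exact mul_le_mul hμt hx.le (norm_nonneg _) (by positivity)
    have hsub : Metric.ball x ρ ⊆ Metric.ball (μ • x) (2 * ρ) := by
      apply Metric.ball_subset_ball'
      linarith
    calc ENNReal.ofReal (c * ρ ^ N) * ENNReal.ofReal ((v (μ • x) - v x) ^ 2)
        = ∫⁻ _ in Metric.ball x ρ, ENNReal.ofReal ((v (μ • x) - v x) ^ 2) := by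
          rw [setLIntegral_const, volume_ball_eq x hρ0.le, mul_comm]
      _ ≤ ∫⁻ y in Metric.ball x ρ, (ENNReal.ofReal 2 * ENNReal.ofReal ((v (μ • x) - v y) ^ 2) +
            ENNReal.ofReal 2 * ENNReal.ofReal ((v x - v y) ^ 2)) := by
          refine lintegral_mono fun y => ?_
          rw [← ENNReal.ofReal_mul zero_le_two, ← ENNReal.ofReal_mul zero_le_two,
            ← ENNReal.ofReal_add (by positivity) (by positivity)]
          apply ENNReal.ofReal_le_ofReal
          nlinarith [sq_nonneg ((v (μ • x) - v y) + (v x - v y))]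
      _ = ENNReal.ofReal 2 * (∫⁻ y in Metric.ball x ρ, ENNReal.ofReal ((v (μ • x) - v y) ^ 2)) +
            ENNReal.ofReal 2 * ∫⁻ y in Metric.ball x ρ, ENNReal.ofReal ((v x - v y) ^ 2) := by
          rw [lintegral_add_left (by fun_prop), lintegral_const_mul' _ _ ENNReal.ofReal_ne_top,
            lintegral_const_mul' _ _ ENNReal.ofReal_ne_top]
      _ ≤ ENNReal.ofReal 2 * (ENNReal.ofReal ((2 * ρ) ^ κ) * g (μ • x)) +
            ENNReal.ofReal 2 * (ENNReal.ofReal (ρ ^ κ) * g x) := by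
          gcongr
          · exact (lintegral_mono_set hsub).trans
              (lintegral_ball_sq_sub_le hs v (μ • x) (by positivity))
          · exact lintegral_ball_sq_sub_le hs v x hρ0
      _ = _ := by
          rw [ENNReal.ofReal_mul zero_le_two, ENNReal.ofReal_mul zero_le_two, mul_assoc, mul_assoc]
  have hvμ : Measurable (fun x => v (μ • x)) := hv.comp (measurable_const_smul μ)
  have hgμ : Measurable (fun x => g (μ • x)) := hgm.comp (measurable_const_smul μ)
  have hG := gagliardoSq_nonneg N s v
  have hmain : ENNReal.ofReal (c * ρ ^ N) *
      ∫⁻ x in Metric.ball 0 R, ENNReal.ofReal ((v (μ • x) - v x) ^ 2) ≤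
      ENNReal.ofReal ((2 * (2 * ρ) ^ κ + 2 * ρ ^ κ) * gagliardoSq N s v) := by
    rw [← lintegral_const_mul' _ _ ENNReal.ofReal_ne_top]
    calc _ ≤ ∫⁻ x in Metric.ball 0 R, (ENNReal.ofReal (2 * (2 * ρ) ^ κ) * g (μ • x) +
          ENNReal.ofReal (2 * ρ ^ κ) * g x) :=
          setLIntegral_mono' Metric.isOpen_ball.measurableSet hpt
      _ ≤ ∫⁻ x, (ENNReal.ofReal (2 * (2 * ρ) ^ κ) * g (μ • x) + ENNReal.ofReal (2 * ρ ^ κ) * g x) :=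
          setLIntegral_le_lintegral _ _
      _ = ENNReal.ofReal (2 * (2 * ρ) ^ κ) * (∫⁻ x, g (μ • x)) +
            ENNReal.ofReal (2 * ρ ^ κ) * ∫⁻ x, g x := by
          rw [lintegral_add_left (by fun_prop), lintegral_const_mul' _ _ ENNReal.ofReal_ne_top,
            lintegral_const_mul' _ _ ENNReal.ofReal_ne_top]
      _ ≤ ENNReal.ofReal (2 * (2 * ρ) ^ κ) * (∫⁻ x, g x) +
            ENNReal.ofReal (2 * ρ ^ κ) * ∫⁻ x, g x := by
          exact add_le_add (mul_le_mul' le_rfl (lintegral_comp_smul_le hgm hμ1)) le_rfl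
      _ = _ := by
          rw [hgint, ← ENNReal.ofReal_mul (by positivity), ← ENNReal.ofReal_mul (by positivity),
            ← ENNReal.ofReal_add (by positivity) (by positivity), add_mul]
  have hlint : ∫⁻ x in Metric.ball 0 R, ENNReal.ofReal ((v (μ • x) - v x) ^ 2) ≤
      ENNReal.ofReal (2 * (2 ^ κ + 1) / c * (2 * R) ^ (2 * s) * t ^ (2 * s) *
        gagliardoSq N s v) := by
    have h1 : ENNReal.ofReal (c * ρ ^ N) ≠ 0 := by simp; positivity
    rw [← ENNReal.mul_le_mul_iff_right h1 ENNReal.ofReal_ne_top]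
    refine hmain.trans (le_of_eq ?_)
    rw [← ENNReal.ofReal_mul (by positivity)]
    congr 1
    have h2 : (2 * R) ^ (2 * s) * t ^ (2 * s) = ρ ^ (2 * s) := by
      rw [← Real.mul_rpow (by positivity) ht0.le]; congr 1; rw [hρ]; ring
    have h3 : ρ ^ κ = ρ ^ N * ρ ^ (2 * s) := by
      rw [hκ, Real.rpow_add hρ0, Real.rpow_natCast]
    rw [mul_assoc _ ((2 * R) ^ (2 * s)), h2, Real.mul_rpow zero_le_two hρ0.le, h3]
    field_simp
  have hDm : Measurable (fun x => (v (μ • x) - v x) ^ 2) := (hvμ.sub hv).pow_const 2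
  rw [integral_eq_lintegral_of_nonneg_ae (ae_of_all _ fun x => sq_nonneg _)
    hDm.aestronglyMeasurable]
  exact ENNReal.toReal_le_of_le_ofReal (by positivity) hlint

lemma rpow_sub_one_mul_le {a b r : ℝ} (ha : 0 ≤ a) (hb : 0 < b) (hr : 1 < r) :
    b ^ (r - 1) * a ≤ a ^ r / r + (1 - 1 / r) * b ^ r := by
  have h := Real.young_inequality_of_nonneg ha (Real.rpow_nonneg hb.le (r - 1))
    (Real.HolderConjugate.conjExponent hr)
  have h1 : (b ^ (r - 1)) ^ r.conjExponent = b ^ r := by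
    rw [← Real.rpow_mul hb.le]
    have : r - 1 ≠ 0 := by linarith
    congr 1
    unfold Real.conjExponent
    field_simp
  have h2 : b ^ r / r.conjExponent = (1 - 1 / r) * b ^ r := by
    have : r - 1 ≠ 0 := by linarith
    unfold Real.conjExponent
    field_simp
  rw [h1, h2] at h
  linarith

lemma rpow_sub_rpow_mul_sub_le {a b r : ℝ} (ha : 0 < a) (hb : 0 < b) (hr : 2 < r) :
    (b ^ (r - 1) - a ^ (r - 1)) * (b - a) ≤
      (r - 1) * (a ^ (r - 2) * (b - a) ^ 2 + b ^ (r - 2) * (b - a) ^ 2) := by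
  have key : ∀ {a b : ℝ}, 0 < a → 0 < b → a ≤ b →
      (b ^ (r - 1) - a ^ (r - 1)) * (b - a) ≤ (r - 1) * (b ^ (r - 2) * (b - a) ^ 2) := by
    intro a b ha hb hab
    have h := rpow_sub_one_mul_le ha.le hb (r := r - 1) (by linarith)
    have h1 : r - 1 - 1 = r - 2 := by ring
    have h2 : b ^ (r - 1) = b ^ (r - 2) * b := by
      rw [← Real.rpow_add_one hb.ne']; congr 1; ring
    rw [h1] at h
    have hr1 : 0 < r - 1 := by linarith
    have h3 : b ^ (r - 1) - a ^ (r - 1) ≤ (r - 1) * (b ^ (r - 2) * (b - a)) := by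
      have h4 := mul_le_mul_of_nonneg_left h hr1.le
      have h5 : (r - 1) * (a ^ (r - 1) / (r - 1) + (1 - 1 / (r - 1)) * b ^ (r - 1)) =
          a ^ (r - 1) + (r - 2) * b ^ (r - 1) := by field_simp; ring
      rw [h5] at h4
      rw [h2] at h4 ⊢
      linarith
    have := mul_le_mul_of_nonneg_right h3 (sub_nonneg.2 hab)
    linarith
  have hr1 : 0 < r - 1 := by linarith
  rcases le_total a b with hab | hab
  · have h := key ha hb hab
    have : 0 ≤ (r - 1) * (a ^ (r - 2) * (b - a) ^ 2) := by positivity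
    linarith
  · have h := key hb ha hab
    have : 0 ≤ (r - 1) * (b ^ (r - 2) * (b - a) ^ 2) := by positivity
    nlinarith

/-- Comparison of the mixed integrals of a power nonlinearity with its primitive along a
dilation. -/
lemma dilation_power_integrals {N : ℕ} {u : RN N → ℝ} (hu : Measurable u) (hu0 : ∀ x, 0 < u x)
    {r : ℝ} (hr : 2 < r) (hint : Integrable fun x => u x ^ r) {μ : ℝ} (hμ : 0 < μ)
    (h1 : Integrable fun x => u x ^ (r - 2) * (u (μ • x) - u x) ^ 2)
    (h2 : Integrable fun x => u (μ • x) ^ (r - 2) * (u (μ • x) - u x) ^ 2) :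
    0 ≤ ((μ ^ N)⁻¹ - 1) * (∫ x, u x ^ r) / r -
        ((∫ x, u x ^ (r - 1) * u (μ • x)) - ∫ x, u x ^ r) ∧
    ((μ ^ N)⁻¹ - 1) * (∫ x, u x ^ r) / r -
        ((∫ x, u x ^ (r - 1) * u (μ • x)) - ∫ x, u x ^ r) ≤
      ((μ ^ N)⁻¹ + 1) * (∫ x, u x ^ r) - (∫ x, u x ^ (r - 1) * u (μ • x)) -
        ∫ x, u (μ • x) ^ (r - 1) * u x ∧
    ((μ ^ N)⁻¹ + 1) * (∫ x, u x ^ r) - (∫ x, u x ^ (r - 1) * u (μ • x)) -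
        (∫ x, u (μ • x) ^ (r - 1) * u x) ≤
      (r - 1) * ((∫ x, u x ^ (r - 2) * (u (μ • x) - u x) ^ 2) +
        ∫ x, u (μ • x) ^ (r - 2) * (u (μ • x) - u x) ^ 2) := by
  have hr1 : 1 < r := by linarith
  have hμm : Measurable (fun x => u (μ • x)) := hu.comp (measurable_const_smul μ)
  have hintμ : Integrable fun x => u (μ • x) ^ r := hint.comp_smul hμ.ne'
  have hW : ∫ x, u (μ • x) ^ r = (μ ^ N)⁻¹ * ∫ x, u x ^ r :=
    integral_comp_smul_RN (fun x => u x ^ r) hμ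
  have hc1 := fun x => rpow_sub_one_mul_le (hu0 (μ • x)).le (hu0 x) hr1
  have hd1 := fun x => rpow_sub_one_mul_le (hu0 x).le (hu0 (μ • x)) hr1
  have hci : Integrable fun x => u (μ • x) ^ r / r + (1 - 1 / r) * u x ^ r :=
    (hintμ.div_const r).add (hint.const_mul _)
  have hdi : Integrable fun x => u x ^ r / r + (1 - 1 / r) * u (μ • x) ^ r :=
    (hint.div_const r).add (hintμ.const_mul _)
  have hc : Integrable fun x => u x ^ (r - 1) * u (μ • x) :=
    hci.mono' ((hu.pow_const _).mul hμm).aestronglyMeasurable (ae_of_all _ fun x => by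
      rw [Real.norm_of_nonneg (mul_nonneg (Real.rpow_nonneg (hu0 x).le _) (hu0 _).le)]
      exact hc1 x)
  have hd : Integrable fun x => u (μ • x) ^ (r - 1) * u x :=
    hdi.mono' ((hμm.pow_const _).mul hu).aestronglyMeasurable (ae_of_all _ fun x => by
      rw [Real.norm_of_nonneg (mul_nonneg (Real.rpow_nonneg (hu0 _).le _) (hu0 _).le)]
      exact hd1 x)
  have hc2 := integral_mono hc hci hc1
  have hd2 := integral_mono hd hdi hd1
  rw [integral_add (hintμ.div_const r) (hint.const_mul _), integral_div, integral_const_mul,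
    hW] at hc2
  rw [integral_add (hint.div_const r) (hintμ.const_mul _), integral_div, integral_const_mul,
    hW] at hd2
  have hr0 : r ≠ 0 := by linarith
  refine ⟨?_, ?_, ?_⟩
  · have e : (1 - 1 / r) * (∫ x, u x ^ r) = (∫ x, u x ^ r) - (∫ x, u x ^ r) / r := by ring
    rw [e] at hc2
    rw [sub_mul, sub_div, one_mul]
    linarith
  · have e : (1 - 1 / r) * ((μ ^ N)⁻¹ * ∫ x, u x ^ r) =
      (μ ^ N)⁻¹ * (∫ x, u x ^ r) - (μ ^ N)⁻¹ * (∫ x, u x ^ r) / r := by ring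
    rw [e] at hd2
    rw [sub_mul, sub_div, one_mul, add_mul, one_mul]
    linarith
  · have hpow : ∀ {a : ℝ}, 0 < a → a ^ (r - 1) * a = a ^ r := fun ha => by
      rw [← Real.rpow_add_one ha.ne']; congr 1; ring
    have hZ : ∀ x, u (μ • x) ^ r + u x ^ r - u x ^ (r - 1) * u (μ • x) -
        u (μ • x) ^ (r - 1) * u x ≤ (r - 1) * (u x ^ (r - 2) * (u (μ • x) - u x) ^ 2 +
          u (μ • x) ^ (r - 2) * (u (μ • x) - u x) ^ 2) := fun x => by
      refine (le_of_eq ?_).trans (rpow_sub_rpow_mul_sub_le (hu0 x) (hu0 (μ • x)) hr)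
      rw [← hpow (hu0 x), ← hpow (hu0 (μ • x))]
      ring
    have hi1 : Integrable fun x => u (μ • x) ^ r + u x ^ r := hintμ.add hint
    have hi2 : Integrable fun x => u (μ • x) ^ r + u x ^ r - u x ^ (r - 1) * u (μ • x) :=
      hi1.sub hc
    have h := integral_mono (hi2.sub hd) ((h1.add h2).const_mul (r - 1)) hZ
    simp only [Pi.sub_apply, Pi.add_apply] at h
    rw [integral_sub hi2 hd, integral_sub hi1 hc, integral_add hintμ hint, integral_const_mul,
      integral_add h1 h2, hW] at h
    linarith

lemma kernel_comp_smul {N : ℕ} (s : ℝ) (f : RN N × RN N → ℝ) {μ : ℝ} (hμ : 0 < μ)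
    (z : RN N × RN N) :
    f (μ • z) / ‖z.1 - z.2‖ ^ ((N : ℝ) + 2 * s) = μ ^ ((N : ℝ) + 2 * s) *
      (f (μ • z) / ‖(μ • z).1 - (μ • z).2‖ ^ ((N : ℝ) + 2 * s)) := by
  have h1 : ‖(μ • z).1 - (μ • z).2‖ = μ * ‖z.1 - z.2‖ := by
    rw [Prod.smul_fst, Prod.smul_snd, ← smul_sub, norm_smul, Real.norm_of_nonneg hμ.le]
  rw [h1, Real.mul_rpow hμ.le (norm_nonneg _)]
  have : 0 < μ ^ ((N : ℝ) + 2 * s) := by positivity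
  field_simp

lemma integral_kernel_comp_smul {N : ℕ} (s : ℝ) (f : RN N × RN N → ℝ) {μ : ℝ} (hμ : 0 < μ) :
    ∫ z : RN N × RN N, f (μ • z) / ‖z.1 - z.2‖ ^ ((N : ℝ) + 2 * s) =
      μ ^ (2 * s) * (μ ^ N)⁻¹ *
        ∫ z : RN N × RN N, f z / ‖z.1 - z.2‖ ^ ((N : ℝ) + 2 * s) := by
  simp_rw [kernel_comp_smul s f hμ]
  rw [integral_const_mul, Measure.volume_eq_prod,
    Measure.integral_comp_smul _ (fun z : RN N × RN N => f z / ‖z.1 - z.2‖ ^ ((N : ℝ) + 2 * s)),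
    Module.finrank_prod, finrank_euclideanSpace_fin, abs_of_pos (by positivity), smul_eq_mul,
    ← mul_assoc]
  congr 1
  rw [Real.rpow_add hμ, Real.rpow_natCast, pow_add]
  field_simp

lemma integrable_kernel_comp_smul {N : ℕ} (s : ℝ) {f : RN N × RN N → ℝ} {μ : ℝ} (hμ : 0 < μ)
    (hf : Integrable fun z : RN N × RN N => f z / ‖z.1 - z.2‖ ^ ((N : ℝ) + 2 * s)) :
    Integrable fun z : RN N × RN N => f (μ • z) / ‖z.1 - z.2‖ ^ ((N : ℝ) + 2 * s) := by
  simp_rw [kernel_comp_smul s f hμ]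
  rw [Measure.volume_eq_prod] at hf ⊢
  exact (hf.comp_smul hμ.ne').const_mul _

lemma MemHs.comp_smul {N : ℕ} {s : ℝ} {u : RN N → ℝ} (h : MemHs N s u) {μ : ℝ} (hμ : 0 < μ) :
    MemHs N s fun x => u (μ • x) :=
  ⟨Integrable.comp_smul (f := fun x => u x ^ 2) h.1 hμ.ne',
    integrable_kernel_comp_smul s (f := fun z => (u z.1 - u z.2) ^ 2) hμ h.2⟩

lemma MemHs.integrable_mul {N : ℕ} {s : ℝ} {u w : RN N → ℝ} (hu : Measurable u)
    (hw : Measurable w) (hu' : MemHs N s u) (hw' : MemHs N s w) :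
    Integrable fun x => u x * w x := by
  refine (hu'.1.add hw'.1).mono' (hu.mul hw).aestronglyMeasurable (ae_of_all _ fun x => ?_)
  simp only [Pi.add_apply]
  rw [Real.norm_eq_abs, abs_le]
  constructor <;> nlinarith [sq_nonneg (u x + w x), sq_nonneg (u x - w x)]

lemma MemHs.integrable_kernel_mul {N : ℕ} {s : ℝ} {u w : RN N → ℝ} (hu : Measurable u)
    (hw : Measurable w) (hu' : MemHs N s u) (hw' : MemHs N s w) :
    Integrable fun z : RN N × RN N =>
      (u z.1 - u z.2) * (w z.1 - w z.2) / ‖z.1 - z.2‖ ^ ((N : ℝ) + 2 * s) := by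
  have hm : Measurable fun z : RN N × RN N =>
      (u z.1 - u z.2) * (w z.1 - w z.2) / ‖z.1 - z.2‖ ^ ((N : ℝ) + 2 * s) := by fun_prop
  refine (hu'.2.add hw'.2).mono' hm.aestronglyMeasurable (ae_of_all _ fun z => ?_)
  simp only [Pi.add_apply]
  have hk : 0 ≤ ‖z.1 - z.2‖ ^ ((N : ℝ) + 2 * s) := by positivity
  rw [← add_div, norm_div, Real.norm_of_nonneg hk]
  refine div_le_div_of_nonneg_right ?_ hk
  rw [Real.norm_eq_abs, abs_le]
  constructor <;>
    nlinarith [sq_nonneg (u z.1 - u z.2 + (w z.1 - w z.2)),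
      sq_nonneg (u z.1 - u z.2 - (w z.1 - w z.2))]

lemma MemHs.sub {N : ℕ} {s : ℝ} {u w : RN N → ℝ} (hu : Measurable u)
    (hw : Measurable w) (hu' : MemHs N s u) (hw' : MemHs N s w) :
    MemHs N s (fun x => w x - u x) := by
  constructor
  · refine ((hw'.1.sub ((hu'.integrable_mul hu hw hw').const_mul 2)).add hu'.1).congr
      (ae_of_all _ fun x => ?_)
    simp only [Pi.add_apply, Pi.sub_apply]
    ring
  · refine ((hw'.2.sub ((hu'.integrable_kernel_mul hu hw hw').const_mul 2)).add hu'.2).congr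
      (ae_of_all _ fun z => ?_)
    simp only [Pi.add_apply, Pi.sub_apply]
    ring

lemma MemHs.integral_sub_sq {N : ℕ} {s : ℝ} {u w : RN N → ℝ} (hu : Measurable u)
    (hw : Measurable w) (hu' : MemHs N s u) (hw' : MemHs N s w) :
    ∫ x, (w x - u x) ^ 2 = (∫ x, w x ^ 2) - 2 * (∫ x, u x * w x) + ∫ x, u x ^ 2 := by
  have h1 := (hu'.integrable_mul hu hw hw').const_mul 2
  have h2 : Integrable fun x => w x ^ 2 - 2 * (u x * w x) := hw'.1.sub h1
  rw [← integral_const_mul, ← integral_sub hw'.1 h1, ← integral_add h2 hu'.1]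
  congr 1; ext x; ring

lemma MemHs.gagliardoSq_sub {N : ℕ} {s : ℝ} {u w : RN N → ℝ} (hu : Measurable u)
    (hw : Measurable w) (hu' : MemHs N s u) (hw' : MemHs N s w) :
    gagliardoSq N s (fun x => w x - u x) = gagliardoSq N s w -
      2 * (∫ z : RN N × RN N,
        (u z.1 - u z.2) * (w z.1 - w z.2) / ‖z.1 - z.2‖ ^ ((N : ℝ) + 2 * s)) +
      gagliardoSq N s u := by
  have h1 := (hu'.integrable_kernel_mul hu hw hw').const_mul 2
  have h2 : Integrable fun z : RN N × RN N =>
      (w z.1 - w z.2) ^ 2 / ‖z.1 - z.2‖ ^ ((N : ℝ) + 2 * s) - 2 *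
        ((u z.1 - u z.2) * (w z.1 - w z.2) / ‖z.1 - z.2‖ ^ ((N : ℝ) + 2 * s)) := hw'.2.sub h1
  unfold gagliardoSq
  rw [← integral_const_mul, ← integral_sub hw'.2 h1, ← integral_add h2 hu'.2]
  congr 1; ext z; ring

lemma IsWeakSolution.eq_of_pos {N : ℕ} {s p q lam : ℝ} {u : RN N → ℝ}
    (h : IsWeakSolution N s p q lam u) (hu0 : ∀ x, 0 < u x) {φ : RN N → ℝ} (hφ : MemHs N s φ) :
    (∫ z : RN N × RN N, (u z.1 - u z.2) * (φ z.1 - φ z.2) / ‖z.1 - z.2‖ ^ ((N : ℝ) + 2 * s))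
      + (∫ x, u x * φ x) = (∫ x, u x ^ (p - 1) * φ x) + lam * ∫ x, u x ^ (q - 1) * φ x := by
  have key : ∀ r : ℝ, ∀ x, |u x| ^ (r - 2) * u x = u x ^ (r - 1) := fun r x => by
    rw [abs_of_pos (hu0 x), ← Real.rpow_add_one (hu0 x).ne']; congr 1; ring
  have := h.2 φ hφ
  simpa only [key] using this

/-- Testing the equation with `u`, `u (μ • ·)` and `u (μ⁻¹ • ·)`. -/
lemma IsWeakSolution.dilation_estimates {N : ℕ} {s p q lam : ℝ} (hs : 0 < s)
    (hN : 2 * s < (N : ℝ)) {u : RN N → ℝ} (hu : Measurable u)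
    (h : IsWeakSolution N s p q lam u) (hu0 : ∀ x, 0 < u x) {μ : ℝ} (hμ : 1 ≤ μ) :
    (1 / 2) * (gagliardoSq N s (fun x => u (μ • x) - u x) + ∫ x, (u (μ • x) - u x) ^ 2) ≤
      (((μ ^ N)⁻¹ + 1) * (∫ x, u x ^ p) - (∫ x, u x ^ (p - 1) * u (μ • x)) -
        ∫ x, u (μ • x) ^ (p - 1) * u x) +
      lam * (((μ ^ N)⁻¹ + 1) * (∫ x, u x ^ q) - (∫ x, u x ^ (q - 1) * u (μ • x)) -
        ∫ x, u (μ • x) ^ (q - 1) * u x) ∧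
    (μ ^ (2 * s) * (μ ^ N)⁻¹ - 1) * gagliardoSq N s u + ((μ ^ N)⁻¹ - 1) * (∫ x, u x ^ 2) -
        (gagliardoSq N s (fun x => u (μ • x) - u x) + ∫ x, (u (μ • x) - u x) ^ 2) =
      2 * (((∫ x, u x ^ (p - 1) * u (μ • x)) - ∫ x, u x ^ p) +
        lam * ((∫ x, u x ^ (q - 1) * u (μ • x)) - ∫ x, u x ^ q)) := by
  have hμ0 : 0 < μ := by linarith
  have hμm : Measurable (fun x => u (μ • x)) := hu.comp (measurable_const_smul μ)
  have hH := h.1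
  have hHμ := hH.comp_smul hμ0
  have hHν := hH.comp_smul (inv_pos.2 hμ0)
  have hpow : ∀ r : ℝ, ∀ x, u x ^ (r - 1) * u x = u x ^ r := fun r x => by
    rw [← Real.rpow_add_one (hu0 x).ne']; congr 1; ring
  have E0 := h.eq_of_pos hu0 hH
  have E1 := h.eq_of_pos hu0 hHμ
  have E2 := h.eq_of_pos hu0 hHν
  simp only [hpow, ← sq] at E0
  change gagliardoSq N s u + _ = _ at E0
  have S1 := hH.gagliardoSq_sub hu hμm hHμ
  have S2 := hH.integral_sub_sq hu hμm hHμ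
  have G1 : gagliardoSq N s (fun x => u (μ • x)) = μ ^ (2 * s) * (μ ^ N)⁻¹ * gagliardoSq N s u :=
    integral_kernel_comp_smul s (fun z => (u z.1 - u z.2) ^ 2) hμ0
  have G2 : ∫ x, u (μ • x) ^ 2 = (μ ^ N)⁻¹ * ∫ x, u x ^ 2 :=
    integral_comp_smul_RN (fun x => u x ^ 2) hμ0
  have hinv : ∀ x : RN N, μ⁻¹ • μ • x = x := fun x => inv_smul_smul₀ hμ0.ne' x
  have X2 := integral_kernel_comp_smul s
    (fun z : RN N × RN N => (u z.1 - u z.2) * (u (μ⁻¹ • z.1) - u (μ⁻¹ • z.2))) hμ0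
  simp only [Prod.smul_fst, Prod.smul_snd, hinv] at X2
  simp only [mul_comm (u (μ • _) - u (μ • _))] at X2
  have Y2 := integral_comp_smul_RN (fun x => u x * u (μ⁻¹ • x)) hμ0
  simp only [hinv] at Y2
  simp only [mul_comm (u (μ • _))] at Y2
  have D : ∀ r : ℝ, ∫ x, u (μ • x) ^ (r - 1) * u x =
      (μ ^ N)⁻¹ * ∫ x, u x ^ (r - 1) * u (μ⁻¹ • x) := fun r => by
    have := integral_comp_smul_RN (fun x => u x ^ (r - 1) * u (μ⁻¹ • x)) hμ0
    simpa only [hinv] using this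
  rw [D p, D q, S1, S2, G1, G2]
  have hMpos : 0 < μ ^ (2 * s) := by positivity
  have hM1 : 1 ≤ μ ^ (2 * s) := Real.one_le_rpow hμ (by positivity)
  have hMJ : μ ^ (2 * s) * (μ ^ N)⁻¹ ≤ 1 := by
    rw [← div_eq_mul_inv, div_le_one (by positivity), ← Real.rpow_natCast]
    exact Real.rpow_le_rpow_of_exponent_le hμ hN.le
  have hJ0 : 0 < (μ ^ N)⁻¹ := by positivity
  have he := gagliardoSq_nonneg N s u
  set e := gagliardoSq N s u
  set m := ∫ x, u x ^ 2
  set M := μ ^ (2 * s)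
  set J := (μ ^ N)⁻¹
  set X := ∫ z : RN N × RN N,
    (u z.1 - u z.2) * (u (μ • z.1) - u (μ • z.2)) / ‖z.1 - z.2‖ ^ ((N : ℝ) + 2 * s)
  set X' := ∫ z : RN N × RN N,
    (u z.1 - u z.2) * (u (μ⁻¹ • z.1) - u (μ⁻¹ • z.2)) / ‖z.1 - z.2‖ ^ ((N : ℝ) + 2 * s)
  set Y := ∫ x, u x * u (μ • x)
  set Y' := ∫ x, u x * u (μ⁻¹ • x)
  have hJX : J * X' = M⁻¹ * X := by rw [X2]; field_simp
  have E2' : M⁻¹ * X + Y = J * (∫ x, u x ^ (p - 1) * u (μ⁻¹ • x)) +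
      lam * (J * ∫ x, u x ^ (q - 1) * u (μ⁻¹ • x)) := by
    rw [Y2, ← hJX]
    linear_combination J * E2
  refine ⟨?_, by linarith⟩
  have hMi1 : M⁻¹ ≤ 1 := inv_le_one_of_one_le₀ hM1
  have hb : 0 ≤ e * ((1 - M⁻¹) * (1 - M * J)) :=
    mul_nonneg he (mul_nonneg (by linarith) (by linarith))
  have hMM : M⁻¹ * M = 1 := inv_mul_cancel₀ hMpos.ne'
  have hgag : 0 ≤ M * J * e - 2 * X + e := by
    rw [← G1, ← S1]; exact gagliardoSq_nonneg _ _ _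
  have hmas : 0 ≤ J * m - 2 * Y + m := by
    rw [← G2, ← S2]; exact integral_nonneg fun x => sq_nonneg _
  have hMi0 : 0 < M⁻¹ := inv_pos.2 hMpos
  have hZ : (J + 1) * (∫ x, u x ^ p) - (∫ x, u x ^ (p - 1) * u (μ • x)) -
        J * (∫ x, u x ^ (p - 1) * u (μ⁻¹ • x)) +
      lam * ((J + 1) * (∫ x, u x ^ q) - (∫ x, u x ^ (q - 1) * u (μ • x)) -
        J * ∫ x, u x ^ (q - 1) * u (μ⁻¹ • x)) =
      1 / 2 * (1 + M⁻¹) * (M * J * e - 2 * X + e) + (J * m - 2 * Y + m) +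
        1 / 2 * (e * ((1 - M⁻¹) * (1 - M * J))) := by
    linear_combination (-(J + 1)) * E0 + E1 + E2' + (-(J * e)) * hMM
  rw [hZ]
  have : 0 ≤ M⁻¹ * (M * J * e - 2 * X + e) := mul_nonneg hMi0.le hgag
  linarith

lemma MemHs.integrable_rpow {N : ℕ} {s : ℝ} (hs : 0 < s) (hN : 2 * s < (N : ℝ)) {u : RN N → ℝ}
    (hu : Measurable u) (huH : MemHs N s u) (hu0 : ∀ x, 0 < u x) {r : ℝ} (hr : 2 ≤ r)
    (hrP : r ≤ critExp N s) : Integrable fun x => u x ^ r := by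
  obtain ⟨S, -, HS⟩ := exists_sobolev hs hN
  refine (huH.1.add (HS u hu huH).1).mono' (hu.pow_const r).aestronglyMeasurable
    (ae_of_all _ fun x => ?_)
  have hx := hu0 x
  simp only [Pi.add_apply, abs_of_pos hx]
  rw [Real.norm_of_nonneg (by positivity)]
  have hP : 0 < u x ^ critExp N s := by positivity
  rcases le_total 1 (u x) with h1 | h1
  · have := Real.rpow_le_rpow_of_exponent_le h1 hrP
    nlinarith [sq_nonneg (u x)]
  · have := Real.rpow_le_rpow_of_exponent_ge hx h1 hr
    rw [Real.rpow_two] at this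
    linarith

lemma exists_dilation_power_integrals_le {N : ℕ} {s : ℝ} (hs : 0 < s) (hN : 2 * s < (N : ℝ))
    {u : RN N → ℝ} (hu : Measurable u) (huH : MemHs N s u) (hu0 : ∀ x, 0 < u x) {r : ℝ}
    (hr : 2 < r) (hrP : r ≤ critExp N s) {ε : ℝ} (hε : 0 < ε) :
    ∃ C R₀ : ℝ, 0 ≤ C ∧ ∀ R, R₀ ≤ R → ∀ μ : ℝ, 1 ≤ μ →
      0 ≤ ((μ ^ N)⁻¹ - 1) * (∫ x, u x ^ r) / r -
        ((∫ x, u x ^ (r - 1) * u (μ • x)) - ∫ x, u x ^ r) ∧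
      ((μ ^ N)⁻¹ - 1) * (∫ x, u x ^ r) / r -
        ((∫ x, u x ^ (r - 1) * u (μ • x)) - ∫ x, u x ^ r) ≤
      ((μ ^ N)⁻¹ + 1) * (∫ x, u x ^ r) - (∫ x, u x ^ (r - 1) * u (μ • x)) -
        ∫ x, u (μ • x) ^ (r - 1) * u x ∧
      ((μ ^ N)⁻¹ + 1) * (∫ x, u x ^ r) - (∫ x, u x ^ (r - 1) * u (μ • x)) -
        (∫ x, u (μ • x) ^ (r - 1) * u x) ≤
      ε * (gagliardoSq N s (fun x => u (μ • x) - u x) + ∫ x, (u (μ • x) - u x) ^ 2) +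
        C * ∫ x in Metric.ball 0 R, (u (μ • x) - u x) ^ 2 := by
  have hr1 : 0 < r - 1 := by linarith
  obtain ⟨C, R₀, hC, -, H⟩ := exists_integral_potential_le hs hN hu huH (fun x => (hu0 x).le)
    (show 0 < r - 2 by linarith) (show r - 2 ≤ critExp N s - 2 by linarith)
    (show 0 < ε / (2 * (r - 1)) by positivity)
  refine ⟨2 * (r - 1) * C, R₀, by positivity, fun R hR μ hμ => ?_⟩
  have hμ0 : 0 < μ := by linarith
  have hμm : Measurable (fun x => u (μ • x)) := hu.comp (measurable_const_smul μ)
  have hvH : MemHs N s fun x => u (μ • x) - u x := huH.sub hu hμm (huH.comp_smul hμ0)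
  have hvm : Measurable fun x => u (μ • x) - u x := hμm.sub hu
  obtain ⟨I1, L1⟩ := H 1 le_rfl _ hvm hvH
  obtain ⟨I2, L2⟩ := H μ hμ _ hvm hvH
  simp only [one_smul] at I1 L1
  obtain ⟨h1, h2, h3⟩ := dilation_power_integrals hu hu0 hr
    (huH.integrable_rpow hs hN hu hu0 hr.le hrP) hμ0 I1 I2
  refine ⟨h1, h2, h3.trans ?_⟩
  have hA : ∫ x in Metric.ball 0 R₀, (u (μ • x) - u x) ^ 2 ≤
      ∫ x in Metric.ball 0 R, (u (μ • x) - u x) ^ 2 :=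
    setIntegral_mono_set hvH.1.integrableOn (ae_of_all _ fun x => sq_nonneg _)
      (Metric.ball_subset_ball hR).eventuallyLE
  have hS := add_le_add L1 L2
  refine (mul_le_mul_of_nonneg_left hS hr1.le).trans ?_
  have hCA := mul_le_mul_of_nonneg_left hA (show 0 ≤ 2 * (r - 1) * C by positivity)
  refine le_trans (le_of_eq ?_) (add_le_add_right hCA _)
  field_simp
  ring

lemma IsWeakSolution.exists_dilation_defect_le {N : ℕ} {s p q lam : ℝ} (hs : 0 < s)
    (hN : 2 * s < (N : ℝ)) (hq : 2 < q) (hqP : q ≤ critExp N s) (hp : 2 < p)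
    (hpP : p ≤ critExp N s) (hlam : 0 < lam) {u : RN N → ℝ} (hu : Measurable u)
    (h : IsWeakSolution N s p q lam u) (hu0 : ∀ x, 0 < u x) :
    ∃ C R : ℝ, 0 ≤ C ∧ 0 < R ∧ ∀ μ : ℝ, 1 ≤ μ →
      gagliardoSq N s (fun x => u (μ • x) - u x) ≤
        C * ∫ x in Metric.ball 0 R, (u (μ • x) - u x) ^ 2 ∧
      |(μ ^ (2 * s) * (μ ^ N)⁻¹ - 1) * gagliardoSq N s u + ((μ ^ N)⁻¹ - 1) * (∫ x, u x ^ 2) -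
          2 * ((μ ^ N)⁻¹ - 1) * ((∫ x, u x ^ p) / p + lam * ((∫ x, u x ^ q) / q))| ≤
        C * ∫ x in Metric.ball 0 R, (u (μ • x) - u x) ^ 2 := by
  obtain ⟨C₁, R₁, hC₁, H₁⟩ := exists_dilation_power_integrals_le hs hN hu h.1 hu0 hp hpP
    (show (0 : ℝ) < 1 / 8 by norm_num)
  obtain ⟨C₂, R₂, hC₂, H₂⟩ := exists_dilation_power_integrals_le hs hN hu h.1 hu0 hq hqP
    (show (0 : ℝ) < 1 / (8 * lam) by positivity)
  refine ⟨8 * (C₁ + lam * C₂), max 1 (max R₁ R₂), by positivity, by positivity, fun μ hμ => ?_⟩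
  obtain ⟨a1, a2, a3⟩ := H₁ (max 1 (max R₁ R₂)) (by simp) μ hμ
  obtain ⟨b1, b2, b3⟩ := H₂ (max 1 (max R₁ R₂)) (by simp) μ hμ
  obtain ⟨d1, d2⟩ := h.dilation_estimates hs hN hu hu0 hμ
  have hg := gagliardoSq_nonneg N s (fun x => u (μ • x) - u x)
  have hv : 0 ≤ ∫ x, (u (μ • x) - u x) ^ 2 := integral_nonneg fun x => sq_nonneg _
  have hA : 0 ≤ ∫ x in Metric.ball 0 (max 1 (max R₁ R₂)), (u (μ • x) - u x) ^ 2 :=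
    integral_nonneg fun x => sq_nonneg _
  replace b1 := mul_le_mul_of_nonneg_left b1 hlam.le
  replace b2 := mul_le_mul_of_nonneg_left b2 hlam.le
  replace b3 := mul_le_mul_of_nonneg_left b3 hlam.le
  set A := ∫ x in Metric.ball 0 (max 1 (max R₁ R₂)), (u (μ • x) - u x) ^ 2
  set g := gagliardoSq N s (fun x => u (μ • x) - u x)
  set m := ∫ x, (u (μ • x) - u x) ^ 2
  have e1 : lam * (1 / (8 * lam) * (g + m) + C₂ * A) = 1 / 8 * (g + m) + lam * C₂ * A := by
    field_simp
  rw [e1] at b3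
  have hC1A : 0 ≤ C₁ * A := by positivity
  have hC2A : 0 ≤ lam * C₂ * A := by positivity
  constructor
  · nlinarith
  · rw [abs_le]
    have e2 : 2 * ((μ ^ N)⁻¹ - 1) * ((∫ x, u x ^ p) / p + lam * ((∫ x, u x ^ q) / q)) =
      2 * (((μ ^ N)⁻¹ - 1) * (∫ x, u x ^ p) / p) +
        2 * (lam * (((μ ^ N)⁻¹ - 1) * (∫ x, u x ^ q) / q)) := by ring
    rw [e2]
    constructor <;> nlinarith

lemma tendsto_mul_two_pow_of_le {a : ℕ → ℝ} (ha : ∀ k, 0 ≤ a k)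
    (h : ∀ᶠ k in atTop, a (k + 1) ≤ 2 / 5 * a k) :
    Tendsto (fun k => a k * 2 ^ k) atTop (𝓝 0) := by
  obtain ⟨K, hK⟩ := eventually_atTop.1 h
  rw [← tendsto_add_atTop_iff_nat K]
  have hb : ∀ n, a (n + K) * 2 ^ (n + K) ≤ (4 / 5) ^ n * (a K * 2 ^ K) := fun n => by
    induction n with
    | zero => simp
    | succ n ih =>
      have h1 := mul_le_mul_of_nonneg_right (hK (n + K) (by omega))
        (show (0 : ℝ) ≤ 2 ^ (n + K + 1) by positivity)
      rw [show n + 1 + K = n + K + 1 by omega]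
      calc _ ≤ _ := h1
        _ = 4 / 5 * (a (n + K) * 2 ^ (n + K)) := by ring
        _ ≤ 4 / 5 * ((4 / 5) ^ n * (a K * 2 ^ K)) := by gcongr
        _ = _ := by ring
  refine squeeze_zero (fun n => mul_nonneg (ha _) (by positivity)) hb ?_
  simpa using (tendsto_pow_atTop_nhds_zero_of_lt_one (r := (4 / 5 : ℝ)) (by norm_num)
    (by norm_num)).mul_const (a K * 2 ^ K)

lemma tendsto_integral_ball_dilation_sub_sq {N : ℕ} {s : ℝ} (hs : 0 < s) (hN : 2 * s < (N : ℝ))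
    {u : RN N → ℝ} (hu : Measurable u) (huH : MemHs N s u) {C R : ℝ} (hR : 0 < R)
    (H : ∀ μ : ℝ, 1 ≤ μ → gagliardoSq N s (fun x => u (μ • x) - u x) ≤
        C * ∫ x in Metric.ball 0 R, (u (μ • x) - u x) ^ 2) :
    Tendsto (fun k : ℕ => (∫ x in Metric.ball 0 R,
      (u (Real.exp ((1 / 2) ^ k) • x) - u x) ^ 2) * 2 ^ k) atTop (𝓝 0) := by
  obtain ⟨D, hD, HD⟩ := exists_integral_ball_dilation_sub_sq_le hs hN hR
  refine tendsto_mul_two_pow_of_le (fun k => integral_nonneg fun x => sq_nonneg _) ?_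
  have ht0 : Tendsto (fun k : ℕ => ((1 / 2 : ℝ) ^ (k + 1))) atTop (𝓝 0) :=
    (tendsto_pow_atTop_nhds_zero_of_lt_one (by norm_num) (by norm_num)).comp
      (tendsto_add_atTop_nat 1)
  have hsm : Tendsto (fun k : ℕ => 3 / 4 * D * C * ((1 / 2 : ℝ) ^ (k + 1)) ^ (2 * s)) atTop
      (𝓝 0) := by
    have := (ht0.rpow_const (p := 2 * s) (Or.inr (by positivity))).const_mul (3 / 4 * D * C)
    rwa [Real.zero_rpow (by positivity), mul_zero] at this
  filter_upwards [hsm.eventually_le_const (show (0 : ℝ) < 1 / 16 by norm_num)] with k hk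
  obtain ⟨t, ht⟩ : ∃ t : ℝ, t = (1 / 2) ^ (k + 1) := ⟨_, rfl⟩
  have htp : 0 < t := by rw [ht]; positivity
  have ht1 : t ≤ 1 := by rw [ht]; exact pow_le_one₀ (by norm_num) (by norm_num)
  have h2t : (1 / 2 : ℝ) ^ k = t + t := by rw [ht, pow_succ]; ring
  rw [← ht] at hk ⊢
  rw [h2t]
  have hm : ∀ c : ℝ, Measurable fun x => u (c • x) := fun c => hu.comp (measurable_const_smul c)
  have hvH : ∀ c : ℝ, 0 < c → MemHs N s fun x => u (c • x) - u x := fun c hc =>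
    huH.sub hu (hm c) (huH.comp_smul hc)
  have hvm : Measurable fun x => u (Real.exp t • x) - u x := (hm (Real.exp t)).sub hu
  have hv := hvH _ (Real.exp_pos t)
  have hvt : MemHs N s fun x => u (Real.exp t • Real.exp t • x) - u (Real.exp t • x) -
      (u (Real.exp t • x) - u x) := hv.sub hvm (hvm.comp (measurable_const_smul (Real.exp t)))
    (hv.comp_smul (Real.exp_pos t))
  have hloc := HD t htp ht1 _ hvm hv
  have hglob := H (Real.exp t) (Real.one_le_exp htp.le)
  have hi1 : IntegrableOn (fun x => (u (Real.exp (t + t) • x) - u x) ^ 2) (Metric.ball 0 R) :=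
    (hvH _ (Real.exp_pos (t + t))).1.integrableOn
  have hi2 := hvt.1.integrableOn (s := Metric.ball 0 R)
  have hrec : ∫ x in Metric.ball 0 R, (u (Real.exp t • x) - u x) ^ 2 ≤
      3 / 8 * (∫ x in Metric.ball 0 R, (u (Real.exp (t + t) • x) - u x) ^ 2) +
      3 / 4 * ∫ x in Metric.ball 0 R, (u (Real.exp t • Real.exp t • x) - u (Real.exp t • x) -
        (u (Real.exp t • x) - u x)) ^ 2 := by
    rw [← integral_const_mul, ← integral_const_mul,
      ← integral_add (hi1.const_mul _) (hi2.const_mul _)]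
    refine integral_mono hv.1.integrableOn ((hi1.const_mul _).add (hi2.const_mul _)) fun x => ?_
    simp only [Real.exp_add, mul_smul]
    nlinarith [sq_nonneg (u (Real.exp t • Real.exp t • x) - u x + 2 *
      (u (Real.exp t • Real.exp t • x) - u (Real.exp t • x) - (u (Real.exp t • x) - u x)))]
  have hA : 0 ≤ ∫ x in Metric.ball 0 R, (u (Real.exp t • x) - u x) ^ 2 :=
    integral_nonneg fun x => sq_nonneg _
  set A := ∫ x in Metric.ball 0 R, (u (Real.exp t • x) - u x) ^ 2
  have h3 : 3 / 4 * (D * t ^ (2 * s) * gagliardoSq N s fun x => u (Real.exp t • x) - u x) ≤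
      1 / 16 * A := by
    calc _ ≤ 3 / 4 * (D * t ^ (2 * s) * (C * A)) := by gcongr
      _ = (3 / 4 * D * C * t ^ (2 * s)) * A := by ring
      _ ≤ _ := by gcongr
  linarith

lemma IsWeakSolution.pohozaev_of_measurable {N : ℕ} {s p q lam : ℝ} (hs : 0 < s)
    (hN : 2 * s < (N : ℝ)) (hq : 2 < q) (hqP : q ≤ critExp N s) (hp : 2 < p)
    (hpP : p ≤ critExp N s) (hlam : 0 < lam) {u : RN N → ℝ} (hu : Measurable u)
    (h : IsWeakSolution N s p q lam u) (hu0 : ∀ x, 0 < u x) :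
    ((N : ℝ) - 2 * s) * gagliardoSq N s u
      = 2 * N * ((1 / p) * lpPow N p u + (lam / q) * lpPow N q u - (1 / 2) * lpPow N 2 u) := by
  obtain ⟨C, R, hC, hR, H⟩ := h.exists_dilation_defect_le hs hN hq hqP hp hpP hlam hu hu0
  have hA := tendsto_integral_ball_dilation_sub_sq hs hN hu h.1 hR fun μ hμ => (H μ hμ).1
  have hlp : ∀ r : ℝ, lpPow N r u = ∫ x, u x ^ r := fun r => by
    simp only [lpPow, abs_of_pos (hu0 _)]
  simp only [hlp, Real.rpow_two]
  set e := gagliardoSq N s u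
  set m := ∫ x, u x ^ 2
  set W := (∫ x, u x ^ p) / p + lam * ((∫ x, u x ^ q) / q) with hW
  have hslope : ∀ c : ℝ, Tendsto (fun k : ℕ => (Real.exp (c * (1 / 2) ^ k) - 1) * 2 ^ k) atTop
      (𝓝 c) := fun c => by
    have hd : HasDerivAt (fun t : ℝ => Real.exp (c * t)) c 0 := by
      simpa using ((hasDerivAt_id (0 : ℝ)).const_mul c).exp
    have ht : Tendsto (fun k : ℕ => (1 / 2 : ℝ) ^ k) atTop (𝓝[≠] 0) :=
      tendsto_nhdsWithin_iff.2 ⟨tendsto_pow_atTop_nhds_zero_of_lt_one (by norm_num) (by norm_num),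
        .of_forall fun k => by simp⟩
    refine (hd.tendsto_slope_zero.comp ht).congr fun k => ?_
    simp [mul_comm]
  have hlim := (((hslope (2 * s - N)).mul_const e).add ((hslope (-N)).mul_const m)).sub
    (((hslope (-N)).const_mul 2).mul_const W)
  have hzero : Tendsto (fun k : ℕ => (Real.exp ((2 * s - N) * (1 / 2) ^ k) - 1) * 2 ^ k * e +
      (Real.exp (-N * (1 / 2) ^ k) - 1) * 2 ^ k * m -
      2 * ((Real.exp (-N * (1 / 2) ^ k) - 1) * 2 ^ k) * W) atTop (𝓝 0) := by
    have hCA := hA.const_mul C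
    rw [mul_zero] at hCA
    refine squeeze_zero_norm (fun k => ?_) hCA
    have hb := (H (Real.exp ((1 / 2) ^ k)) (Real.one_le_exp (by positivity))).2
    have e1 : (Real.exp ((1 / 2) ^ k) ^ N)⁻¹ = Real.exp (-N * (1 / 2) ^ k) := by
      rw [← Real.exp_nat_mul, ← Real.exp_neg, neg_mul]
    have e2 : Real.exp ((1 / 2) ^ k) ^ (2 * s) * Real.exp (-N * (1 / 2) ^ k) =
        Real.exp ((2 * s - N) * (1 / 2) ^ k) := by
      rw [← Real.exp_mul, ← Real.exp_add]; congr 1; ring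
    rw [e1, e2] at hb
    have h2k : (0 : ℝ) < 2 ^ k := by positivity
    have hb' := mul_le_mul_of_nonneg_right hb h2k.le
    rw [mul_assoc C] at hb'
    refine le_trans (le_of_eq ?_) hb'
    rw [Real.norm_eq_abs, ← abs_of_pos h2k, ← abs_mul, abs_of_pos h2k]
    congr 1
    ring
  have key := tendsto_nhds_unique hlim hzero
  rw [hW] at key
  ring_nf at key ⊢
  linarith

lemma ae_prod_eq_of_ae_eq {N : ℕ} {u w : RN N → ℝ} (h : u =ᵐ[volume] w) :
    ∀ᵐ z : RN N × RN N, u z.1 = w z.1 ∧ u z.2 = w z.2 := by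
  rw [Measure.volume_eq_prod]
  exact (Measure.quasiMeasurePreserving_fst.ae h).and (Measure.quasiMeasurePreserving_snd.ae h)

lemma gagliardoSq_congr {N : ℕ} (s : ℝ) {u w : RN N → ℝ} (h : u =ᵐ[volume] w) :
    gagliardoSq N s u = gagliardoSq N s w :=
  integral_congr_ae ((ae_prod_eq_of_ae_eq h).mono fun z hz => by simp only [hz.1, hz.2])

lemma lpPow_congr {N : ℕ} (r : ℝ) {u w : RN N → ℝ} (h : u =ᵐ[volume] w) :
    lpPow N r u = lpPow N r w :=
  integral_congr_ae (h.mono fun x hx => by simp only [hx])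

lemma IsWeakSolution.congr {N : ℕ} {s p q lam : ℝ} {u w : RN N → ℝ}
    (hu : IsWeakSolution N s p q lam u) (h : u =ᵐ[volume] w) :
    IsWeakSolution N s p q lam w := by
  have h2 := ae_prod_eq_of_ae_eq h
  refine ⟨⟨hu.1.1.congr (h.mono fun x hx => by simp only [hx]),
    hu.1.2.congr (h2.mono fun z hz => by simp only [hz.1, hz.2])⟩, fun φ hφ => ?_⟩
  convert hu.2 φ hφ using 2
  · exact integral_congr_ae (h2.mono fun z hz => by simp only [hz.1, hz.2])
  · exact integral_congr_ae (h.mono fun x hx => by simp only [hx])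
  · exact integral_congr_ae (h.mono fun x hx => by simp only [hx])
  · congr 1
    exact integral_congr_ae (h.mono fun x hx => by simp only [hx])

lemma MemHs.exists_measurable_pos {N : ℕ} {s : ℝ} {u : RN N → ℝ} (hu : MemHs N s u)
    (hu0 : ∀ x, 0 < u x) :
    ∃ w : RN N → ℝ, Measurable w ∧ (∀ x, 0 < w x) ∧ u =ᵐ[volume] w := by
  have hm : AEMeasurable u := by
    refine hu.1.aemeasurable.sqrt.congr (ae_of_all _ fun x => ?_)
    exact Real.sqrt_sq (hu0 x).le
  refine ⟨fun x => if 0 < hm.mk u x then hm.mk u x else 1, ?_, fun x => ?_, ?_⟩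
  · exact Measurable.ite (measurableSet_lt measurable_const hm.measurable_mk) hm.measurable_mk
      measurable_const
  · dsimp only
    split_ifs with hx
    · exact hx
    · exact one_pos
  · filter_upwards [hm.ae_eq_mk] with x hx
    rw [← hx, if_pos (hu0 x)]

/-- Corollary 2.5: Pohozaev identity.
Any positive weak solution of `(P_λ)` satisfies
`(N-2s)[u]_{H^s}² = 2N((1/p)‖u‖_p^p + (λ/q)‖u‖_q^q - ½‖u‖₂²)`. -/
theorem pohozaev_identity
    (N : ℕ) (s p q lam : ℝ)
    (hs : s ∈ Set.Ioo (0 : ℝ) 1) (hN : 2 * s < (N : ℝ))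
    (hq : 2 < q) (hqp : q < p) (hp : p ≤ critExp N s) (hlam : 0 < lam)
    (u : RN N → ℝ)
    (hu : IsWeakSolution N s p q lam u) (hupos : ∀ x, 0 < u x) :
    ((N : ℝ) - 2 * s) * gagliardoSq N s u
      = 2 * N * ((1 / p) * lpPow N p u + (lam / q) * lpPow N q u - (1 / 2) * lpPow N 2 u) := by
  have hs0 := hs.1
  obtain ⟨w, hw, hw0, h⟩ := hu.1.exists_measurable_pos hupos
  rw [gagliardoSq_congr s h, lpPow_congr p h, lpPow_congr q h, lpPow_congr 2 h]
  exact (hu.congr h).pohozaev_of_measurable hs0 hN hq (hqp.le.trans hp) (hq.trans hqp) hp hlam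
    hw hw0
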